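/- arXiv:1410.8838 — 3 statements merged into one kernel-verified Lean document; each statement's English description precedes it below -/
import Mathlib

section
/- The algebra 𝓔 is unit-regular: for every a ∈ 𝓔 there exists an invertible element u of 𝓔 with a·u·a = a. In particular 𝓔 is a von Neumann regular ring. -/
set_option synthInstance.maxHeartbeats 1000000
set_option maxHeartbeats 1000000

namespace LampAlg

open Polynomial

/-- a sequence `a : ℕ → k` is rational if its generating function is the power series
expansion of a rational function `P/Q` with `Q(0) = 1`. -/
def IsRational {k : Type*} [Field k] (a : ℕ → k) : Prop :=
  ∃ P Q : k[X], Q.coeff 0 = 1 ∧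
    (PowerSeries.mk a) * (Q : PowerSeries k) = (P : PowerSeries k)

/-- the set `𝓠` of quotients `a·b⁻¹` of rational sequences with `b` pointwise nonzero. -/
def Qset (k : Type*) [Field k] : Set (ℕ → k) :=
  {q | ∃ a b : ℕ → k, IsRational a ∧ IsRational b ∧ (∀ n : ℕ, b n ≠ 0) ∧
    q = fun n => a n * (b n)⁻¹}

/-- `T'' = ∏_{n=0}^∞ M_{n+1}(k)`. -/
abbrev TProd (k : Type*) [Field k] : Type _ :=
  ∀ n : ℕ, Matrix (Fin (n + 1)) (Fin (n + 1)) k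

/-- the element `s = (sₙ)ₙ ∈ T''`, where `sₙ` is the lower shift matrix of size `n+1`. -/
def sT (k : Type*) [Field k] : TProd k :=
  fun n => Matrix.of fun (a b : Fin (n + 1)) => if (a : ℕ) = (b : ℕ) + 1 then (1 : k) else 0

/-- the element `s* ∈ T''`, the componentwise transpose of `s`. -/
def sstarT (k : Type*) [Field k] : TProd k :=
  fun n => (sT k n).transpose

/-- the central element `ψ(q) = (q(n)·I_{n+1})ₙ` of `T''` attached to a sequence `q`. -/
def ψ {k : Type*} [Field k] (q : ℕ → k) : TProd k :=
  fun n => q n • (1 : Matrix (Fin (n + 1)) (Fin (n + 1)) k)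

/-- the unital `k`-subalgebra `𝓔` of `T''` generated by `s`, `s*`, the inverses
`f(s)⁻¹` and `f(s*)⁻¹` for `f ∈ Σ = {f : f(0) = 1}` (these are units of `T''`, and
`Ring.inverse` produces their inverses), and the elements `ψ(q)(1 − s s*)` for `q ∈ 𝓠`. -/
noncomputable def Ealg (k : Type*) [Field k] : Subalgebra k (TProd k) :=
  Algebra.adjoin k ({sT k, sstarT k} ∪
    {y : TProd k | ∃ p : k[X], p.coeff 0 = 1 ∧
      (y = Ring.inverse (aeval (sT k) p) ∨ y = Ring.inverse (aeval (sstarT k) p))} ∪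
    {y : TProd k | ∃ q : ℕ → k, q ∈ Qset k ∧ y = ψ q * (1 - sT k * sstarT k)})

end LampAlg

namespace LampAlg

open Polynomial

theorem dvd_eval_of_roots {R : Type*} [CommRing R] [IsDomain R] (P : R[X]) (π : R) (Z : Finset R)
    (hZ : ∀ z ∈ Z, P.eval z = 0) (hP : ∀ j, Z.card ≤ j → π ∣ P.coeff j) (t : R) :
    π ∣ P.eval t := by
  rcases eq_or_ne P 0 with rfl | hP0
  · simp
  obtain ⟨Q, hQ⟩ : (Z.val.map fun z => X - C z).prod ∣ P := by
    rw [Multiset.prod_X_sub_C_dvd_iff_le_roots hP0, Multiset.le_iff_subset Z.nodup]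
    intro z hz
    exact (mem_roots hP0).2 (hZ z hz)
  set M := (Z.val.map fun z => X - C z).prod with hM
  have hMm : M.Monic := monic_multiset_prod_of_monic _ _ fun z _ => monic_X_sub_C z
  have hMd : M.natDegree = Z.card := by
    rw [hM, natDegree_multiset_prod_X_sub_C_eq_card]
    rfl
  let f := Ideal.Quotient.mk (Ideal.span {π})
  have hf : ∀ x, f x = 0 ↔ π ∣ x := fun x => by
    rw [Ideal.Quotient.eq_zero_iff_mem, Ideal.mem_span_singleton]
  have hQ0 : Q.map f = 0 := by
    by_contra hne
    have : Nontrivial (R ⧸ Ideal.span {π}) := by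
      by_contra hn
      rw [not_nontrivial_iff_subsingleton] at hn
      exact hne (Subsingleton.elim _ _)
    have h1 : (P.map f).natDegree = Z.card + (Q.map f).natDegree := by
      rw [hQ, Polynomial.map_mul, (hMm.map f).natDegree_mul' hne, hMm.natDegree_map, hMd]
    have h2 : P.map f ≠ 0 := by
      rw [hQ, Polynomial.map_mul]
      exact fun h => hne ((hMm.map f).mul_right_eq_zero_iff.1 h)
    apply leadingCoeff_ne_zero.2 h2
    rw [leadingCoeff, coeff_map, hf]
    exact hP _ (by omega)
  rw [← hf, ← eval₂_at_apply, ← eval_map, hQ, Polynomial.map_mul, hQ0]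
  simp

theorem exists_factorial_mul_eq_pow {p : ℕ} [Fact p.Prime] (hp : 3 ≤ p) (i : ℕ) :
    ∃ w : ℤ_[p], (i.factorial : ℤ_[p]) * w = (p : ℤ_[p]) ^ i ∧ (p : ℤ_[p]) ^ (i / 2) ∣ w := by
  have hpp : p.Prime := Fact.out
  set v := padicValNat p i.factorial with hv
  have h1 : (p - 1) * v = i - (p.digits i).sum := sub_one_mul_padicValNat_factorial i
  have h2 : 2 * v ≤ i := by
    have : 2 * v ≤ (p - 1) * v := Nat.mul_le_mul_right _ (by omega)
    omega
  obtain ⟨m, hm⟩ : p ^ v ∣ i.factorial := pow_padicValNat_dvd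
  have hpm : ¬ p ∣ m := by
    rintro ⟨c, rfl⟩
    have : p ^ (v + 1) ∣ i.factorial := ⟨c, by rw [hm]; ring⟩
    exact pow_succ_padicValNat_not_dvd i.factorial_ne_zero this
  have hu : IsUnit (m : ℤ_[p]) := by
    rw [PadicInt.isUnit_iff]
    by_contra h
    have := PadicInt.norm_lt_one_iff_dvd (m : ℤ_[p]) |>.1
      (lt_of_le_of_ne (PadicInt.norm_le_one _) h)
    have h3 : ‖((m : ℤ) : ℤ_[p])‖ < 1 := by
      simpa using (PadicInt.norm_lt_one_iff_dvd (m : ℤ_[p])).2 this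
    rw [PadicInt.norm_int_lt_one_iff_dvd] at h3
    exact hpm (by exact_mod_cast h3)
  obtain ⟨n, hn⟩ := hu.exists_right_inv
  refine ⟨(p : ℤ_[p]) ^ (i - v) * n, ?_, ?_⟩
  · rw [hm]
    push_cast
    calc (p : ℤ_[p]) ^ v * m * (p ^ (i - v) * n) = p ^ v * p ^ (i - v) * (m * n) := by ring
      _ = _ := by rw [hn, mul_one, ← pow_add]; congr 1; omega
  · exact Dvd.dvd.mul_right (pow_dvd_pow _ (by omega)) _

/-- Hansel's lemma: the binomial transform of `i ↦ pⁱ dᵢ` vanishes identically as soon as it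
vanishes infinitely often. -/
theorem binomial_sum_eq_zero {p : ℕ} (hpp : p.Prime) (hp : 3 ≤ p) (d : ℕ → ℤ)
    (hinf : {m : ℕ | ∑ i ∈ Finset.range (m + 1), (m.choose i : ℤ) * p ^ i * d i = 0}.Infinite)
    (t : ℕ) : ∑ i ∈ Finset.range (t + 1), (t.choose i : ℤ) * p ^ i * d i = 0 := by
  have : Fact p.Prime := ⟨hpp⟩
  choose w hw hwd using fun i => exists_factorial_mul_eq_pow hp i
  set b : ℕ → ℤ := fun m => ∑ i ∈ Finset.range (m + 1), (m.choose i : ℤ) * p ^ i * d i with hb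
  let P : ℕ → ℤ_[p][X] := fun n =>
    ∑ i ∈ Finset.range (n + 1), C (w i * (d i : ℤ_[p])) * descPochhammer ℤ_[p] i
  have hP : ∀ n m, m ≤ n → (P n).eval (m : ℤ_[p]) = (b m : ℤ_[p]) := by
    intro n m hmn
    have : (P n).eval (m : ℤ_[p]) =
        ∑ i ∈ Finset.range (n + 1), (m.choose i : ℤ_[p]) * p ^ i * d i := by
      simp only [P, eval_finsetSum]
      refine Finset.sum_congr rfl fun i _ => ?_
      rw [eval_mul, eval_C, descPochhammer_eval_eq_descFactorial,
        Nat.descFactorial_eq_factorial_mul_choose, ← hw]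
      push_cast
      ring
    rw [this, hb]
    push_cast
    symm
    refine Finset.sum_subset (Finset.range_mono (by omega)) fun i _ hi => ?_
    rw [Nat.choose_eq_zero_of_lt (by simpa using hi)]
    simp
  have key : ∀ j : ℕ, (p : ℤ_[p]) ^ j ∣ (b t : ℤ_[p]) := by
    intro j
    obtain ⟨Z, hZs, hZc⟩ := hinf.exists_subset_card_eq (2 * j)
    obtain ⟨n, hn⟩ : ∃ n, t ≤ n ∧ ∀ m ∈ Z, m ≤ n :=
      ⟨t + Z.sup id, by omega, fun m hm => (Finset.le_sup (f := id) hm).trans (by simp)⟩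
    rw [← hP n t hn.1]
    refine dvd_eval_of_roots (P n) _ (Z.map (Nat.castEmbedding (R := ℤ_[p]))) ?_ ?_ _
    · intro z hz
      obtain ⟨m, hm, rfl⟩ := Finset.mem_map.1 hz
      have h0 : b m = 0 := hZs hm
      simp only [Nat.castEmbedding_apply]
      rw [hP n m (hn.2 m hm), h0, Int.cast_zero]
    · intro l hl
      rw [Finset.card_map, hZc] at hl
      simp only [P, finsetSum_coeff, coeff_C_mul]
      refine Finset.dvd_sum fun i _ => ?_
      rcases lt_or_ge i l with h | h
      · rw [coeff_eq_zero_of_natDegree_lt (by rwa [descPochhammer_natDegree]), mul_zero]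
        exact dvd_zero _
      · exact (((pow_dvd_pow _ (by omega)).trans (hwd i)).mul_right _).mul_right _
  by_contra hne
  have h1 := Int.le_of_dvd (abs_pos.2 hne)
    ((dvd_abs _ _).2 ((PadicInt.pow_p_dvd_int_iff (b t).natAbs (b t)).1 (key _)))
  have h2 := Nat.lt_pow_self (n := (b t).natAbs) hpp.one_lt
  have h3 : ((p ^ (b t).natAbs : ℕ) : ℤ) ≤ (b t).natAbs := by
    push_cast
    exact h1
  omega

open Matrix in
theorem int_dotProduct_pow_eq_zero {n : Type*} [Fintype n] [DecidableEq n] {p : ℕ}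
    (hpp : p.Prime) (hp : 3 ≤ p) (A : Matrix n n ℤ) (N : ℕ)
    (hN : (A.map (Int.cast : ℤ → ZMod p)) ^ N = 1) (r : ℕ) (u v : n → ℤ)
    (hinf : {m : ℕ | u ⬝ᵥ (A ^ (r + N * m) *ᵥ v) = 0}.Infinite) (t : ℕ) :
    u ⬝ᵥ (A ^ (r + N * t) *ᵥ v) = 0 := by
  have h1 : ∀ i j, ∃ b : ℤ, (A ^ N - 1) i j = p * b := by
    intro i j
    have h2 : (Int.castRingHom (ZMod p)).mapMatrix (A ^ N - 1) = 0 := by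
      rw [map_sub, map_pow, map_one, sub_eq_zero]
      exact hN
    have h3 := congrFun (congrFun h2 i) j
    rw [RingHom.mapMatrix_apply, map_apply, Matrix.zero_apply, eq_intCast,
      ZMod.intCast_zmod_eq_zero_iff_dvd] at h3
    exact h3
  choose B hB using h1
  have hAN : A ^ N = (p : ℤ) • Matrix.of B + 1 := by
    rw [← sub_eq_iff_eq_add]
    ext i j
    simp [hB]
  have key : ∀ m, u ⬝ᵥ (A ^ (r + N * m) *ᵥ v) = ∑ i ∈ Finset.range (m + 1),
      (m.choose i : ℤ) * p ^ i * (u ⬝ᵥ ((A ^ r * (Matrix.of B) ^ i) *ᵥ v)) := by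
    intro m
    rw [pow_add, pow_mul, hAN, (Commute.one_right _).add_pow, Finset.mul_sum, sum_mulVec,
      dotProduct_sum]
    refine Finset.sum_congr rfl fun i _ => ?_
    rw [one_pow, mul_one, _root_.smul_pow, ← nsmul_eq_mul', mul_smul_comm, mul_smul_comm,
      smul_mulVec, smul_mulVec, dotProduct_smul, dotProduct_smul]
    simp [mul_assoc]
  simp only [key] at hinf ⊢
  exact binomial_sum_eq_zero hpp hp _ hinf t

open Matrix in
theorem mvPolynomial_dotProduct_pow_eq_zero {σ n : Type*} [Fintype n] [DecidableEq n]
    (A : Matrix n n (MvPolynomial σ ℤ)) (hA : A.det ≠ 0) :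
    ∃ N > 0, ∀ (r : ℕ) (u v : n → MvPolynomial σ ℤ),
      {m : ℕ | u ⬝ᵥ (A ^ (r + N * m) *ᵥ v) = 0}.Infinite →
        ∀ t, u ⬝ᵥ (A ^ (r + N * t) *ᵥ v) = 0 := by
  obtain ⟨c, hc⟩ : ∃ c : σ → ℤ, MvPolynomial.eval c A.det ≠ 0 := by
    by_contra! h
    exact hA (MvPolynomial.funext fun x => by rw [h, map_zero])
  obtain ⟨p, hple, hpp⟩ := Nat.exists_infinite_primes ((MvPolynomial.eval c A.det).natAbs + 3)
  have : Fact p.Prime := ⟨hpp⟩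
  let ev : (σ → ℤ) → Matrix n n (ZMod p) := fun x =>
    (Int.castRingHom (ZMod p)).mapMatrix ((MvPolynomial.eval x).mapMatrix A)
  have hunit : IsUnit (ev c) := by
    rw [Matrix.isUnit_iff_isUnit_det, ← RingHom.map_det, ← RingHom.map_det, isUnit_iff_ne_zero]
    intro h0
    rw [eq_intCast, ZMod.intCast_zmod_eq_zero_iff_dvd] at h0
    have := Int.le_of_dvd (abs_pos.2 hc) ((dvd_abs _ _).2 h0)
    rw [Int.abs_eq_natAbs] at this
    omega
  have hcongr : ∀ z : σ → ℤ, ev (fun i => c i + p * z i) = ev c := by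
    intro z
    ext i j
    simp only [ev, RingHom.mapMatrix_apply, map_apply, MvPolynomial.eval,
      MvPolynomial.coe_eval₂Hom]
    rw [MvPolynomial.hom_eval₂, MvPolynomial.hom_eval₂]
    congr 1
    funext i
    simp
  obtain ⟨U, hU⟩ := hunit
  refine ⟨Nat.card (Matrix n n (ZMod p))ˣ, Nat.card_pos, fun r u v hinf t => ?_⟩
  set N := Nat.card (Matrix n n (ZMod p))ˣ
  have hcN : ev c ^ N = 1 := by
    rw [← hU, ← Units.val_pow_eq_pow_val, pow_card_eq_one', Units.val_one]
  have heval : ∀ (x : σ → ℤ) (m : ℕ), MvPolynomial.eval x (u ⬝ᵥ (A ^ m *ᵥ v)) =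
      (MvPolynomial.eval x ∘ u) ⬝ᵥ
        (((MvPolynomial.eval x).mapMatrix A) ^ m *ᵥ (MvPolynomial.eval x ∘ v)) := by
    intro x m
    rw [RingHom.map_dotProduct, ← map_pow]
    congr 1
    funext i
    exact RingHom.map_mulVec _ _ _ _
  refine MvPolynomial.funext_set (fun i => Set.range fun z : ℤ => c i + p * z) ?_ ?_
  · intro i
    refine Set.infinite_range_of_injective fun x y hxy => ?_
    simpa [hpp.ne_zero] using hxy
  · intro x hx
    choose z hz using fun i => hx i (Set.mem_univ i)
    obtain rfl : (fun i => c i + p * z i) = x := funext hz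
    rw [map_zero, heval]
    refine int_dotProduct_pow_eq_zero hpp (by omega) _ N ?_ r _ _ ?_ t
    · have := hcongr z
      rw [← this] at hcN
      exact hcN
    · refine hinf.mono fun m hm => ?_
      have : u ⬝ᵥ (A ^ (r + N * m) *ᵥ v) = 0 := hm
      rw [Set.mem_ofPred_eq, ← heval, this, map_zero]

/-- the backward shift `a ↦ (n ↦ a (n + 1))` on sequences. -/
noncomputable abbrev shift (K : Type*) [Field K] : Module.End K (ℕ → K) :=
  LinearMap.funLeft K K Nat.succ

theorem shift_pow_apply {K : Type*} [Field K] (i : ℕ) (a : ℕ → K) (n : ℕ) :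
    (shift K ^ i) a n = a (n + i) := by
  induction i generalizing n with
  | zero => simp
  | succ i ih =>
    rw [pow_succ', Module.End.mul_apply, LinearMap.funLeft_apply, ih]
    congr 1
    omega

open Matrix in
/-- the companion matrix of `h`, scaled by the leading coefficient. -/
def scaledCompanion {R : Type*} [CommRing R] (h : R[X]) (d : ℕ) :
    Matrix (Fin (d + 1)) (Fin (d + 1)) R :=
  Matrix.of fun i j =>
    if (i : ℕ) = d then - h.coeff j else if (j : ℕ) = i + 1 then h.coeff (d + 1) else 0

open Matrix in
theorem scaledCompanion_det_ne_zero {R : Type*} [CommRing R] [IsDomain R] (h : R[X]) (d : ℕ)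
    (h0 : h.coeff 0 ≠ 0) (hd : h.coeff (d + 1) ≠ 0) : (scaledCompanion h d).det ≠ 0 := by
  intro hdet
  obtain ⟨v, hv, hv0⟩ := Matrix.exists_mulVec_eq_zero_iff.2 hdet
  have h1 : ∀ j : Fin d, v j.succ = 0 := by
    intro j
    have := congrFun hv0 j.castSucc
    rw [mulVec, dotProduct, Finset.sum_eq_single j.succ] at this
    · simpa [scaledCompanion, j.isLt.ne, hd] using this
    · intro b _ hb
      have : (b : ℕ) ≠ j + 1 := fun h => hb (Fin.ext (by simpa using h))
      simp [scaledCompanion, j.isLt.ne, this]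
    · simp
  have h2 := congrFun hv0 (Fin.last d)
  rw [mulVec, dotProduct, Fin.sum_univ_succ] at h2
  simp only [h1, mul_zero, Finset.sum_const_zero, add_zero] at h2
  have h3 : v 0 = 0 := by simpa [scaledCompanion, h0] using h2
  apply hv
  funext i
  exact Fin.cases h3 h1 i

open Matrix in
theorem scaledCompanion_mulVec {R K : Type*} [CommRing R] [Field K] [Algebra R K] (h : R[X])
    (d : ℕ) (hd : h.natDegree = d + 1) (b : ℕ → K)
    (hb : aeval (shift K) (h.map (algebraMap R K)) b = 0) (n : ℕ) (i : Fin (d + 1)) :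
    ∑ j, (scaledCompanion h d i j) • b (n + j) = h.coeff (d + 1) • b (n + 1 + i) := by
  by_cases hi : (i : ℕ) = d
  · have h1 := congrFun hb n
    rw [aeval_eq_sum_range' (n := d + 1 + 1)
      (lt_of_le_of_lt natDegree_map_le (by omega)), LinearMap.sum_apply, Finset.sum_apply,
      Finset.sum_range_succ] at h1
    simp only [coeff_map, LinearMap.smul_apply, Pi.smul_apply, shift_pow_apply, Pi.zero_apply,
      algebraMap_smul] at h1
    have h2 : ∀ j, scaledCompanion h d i j = - h.coeff j := fun j => by simp [scaledCompanion, hi]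
    simp only [h2, neg_smul, Finset.sum_neg_distrib]
    rw [Fin.sum_univ_eq_sum_range (fun j => h.coeff j • b (n + j)) (d + 1), hi,
      neg_eq_iff_add_eq_zero, add_assoc n 1 d, add_comm 1 d]
    exact h1
  · have hlt : (i : ℕ) + 1 < d + 1 := by omega
    rw [Finset.sum_eq_single (⟨i + 1, hlt⟩ : Fin (d + 1))]
    · have h1 : n + ((i : ℕ) + 1) = n + 1 + i := by omega
      simp [scaledCompanion, hi, h1]
    · intro j _ hj
      have : (j : ℕ) ≠ i + 1 := fun h => hj (Fin.ext (by simpa using h))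
      simp [scaledCompanion, hi, this]
    · simp

open Matrix in
theorem scaledCompanion_pow {R K : Type*} [CommRing R] [Field K] [Algebra R K] (h : R[X])
    (d : ℕ) (hd : h.natDegree = d + 1) (b : ℕ → K)
    (hb : aeval (shift K) (h.map (algebraMap R K)) b = 0) (n : ℕ) (i : Fin (d + 1)) :
    ∑ j, ((scaledCompanion h d ^ n) i j) • b j = h.coeff (d + 1) ^ n • b (n + i) := by
  induction n generalizing i with
  | zero => simp [Matrix.one_apply]
  | succ n ih =>
    rw [pow_succ' (scaledCompanion h d)]
    simp only [Matrix.mul_apply, Finset.sum_smul, mul_smul]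
    rw [Finset.sum_comm]
    simp only [← Finset.smul_sum, ih]
    simp only [smul_comm _ (h.coeff (d + 1) ^ n)]
    rw [← Finset.smul_sum, scaledCompanion_mulVec h d hd b hb n i, smul_smul, pow_succ]

theorem exists_period_of_recurrence {σ K : Type*} [Field K] [Algebra (MvPolynomial σ ℤ) K]
    [FaithfulSMul (MvPolynomial σ ℤ) K] (h : (MvPolynomial σ ℤ)[X]) (h0 : h.coeff 0 ≠ 0)
    (b : ℕ → K) (hb : aeval (shift K) (h.map (algebraMap _ K)) b = 0) :
    ∃ N > 0, ∀ r, {m : ℕ | b (r + N * m) = 0}.Infinite → ∀ t, b (r + N * t) = 0 := by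
  rcases hd : h.natDegree with _ | d
  · refine ⟨1, one_pos, fun r _ t => ?_⟩
    obtain ⟨c, rfl⟩ := natDegree_eq_zero.1 hd
    have := congrFun hb (r + 1 * t)
    rw [map_C, aeval_C, Module.algebraMap_end_apply] at this
    rw [coeff_C_zero] at h0
    simpa [h0] using this
  set R := MvPolynomial σ ℤ
  have hlead : h.coeff (d + 1) ≠ 0 := by
    rw [← hd]
    exact leadingCoeff_ne_zero.2 fun h1 => h0 (by rw [h1, coeff_zero])
  obtain ⟨N, hN, key⟩ := mvPolynomial_dotProduct_pow_eq_zero _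
    (scaledCompanion_det_ne_zero h d h0 hlead)
  set A := scaledCompanion h d
  refine ⟨N, hN, fun r hinf t => ?_⟩
  let F := FractionRing R
  let : Algebra F K := FractionRing.liftAlgebra R K
  have hpow : ∀ n, b n = 0 ↔ ∑ j, ((A ^ n) 0 j) • b j = 0 := by
    intro n
    rw [scaledCompanion_pow h d hd b hb n 0, smul_eq_zero]
    simp [hlead]
  have hφ : ∀ φ : Module.Dual F K, ∃ w : Fin (d + 1) → R, ∀ n,
      φ (∑ j, ((A ^ n) 0 j) • b j) = 0 ↔ dotProduct (Pi.single 0 1) ((A ^ n).mulVec w) = 0 := by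
    intro φ
    obtain ⟨e, he⟩ := IsLocalization.exist_integer_multiples_of_finite (nonZeroDivisors R)
      (fun j : Fin (d + 1) => φ (b j))
    choose w hw using he
    refine ⟨w, fun n => ?_⟩
    have he0 : (e : R) ≠ 0 := nonZeroDivisors.coe_ne_zero e
    have h1 : algebraMap R F (dotProduct (Pi.single 0 1) ((A ^ n).mulVec w)) =
        (e : R) • φ (∑ j, ((A ^ n) 0 j) • b j) := by
      rw [single_dotProduct, one_mul, Matrix.mulVec, dotProduct, map_sum, map_sum,
        Finset.smul_sum]
      refine Finset.sum_congr rfl fun j _ => ?_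
      rw [map_mul, hw, ← algebraMap_smul F ((A ^ n) 0 j) (b j), map_smul, algebraMap_smul,
        smul_comm]
      exact (Algebra.smul_def _ _).symm
    rw [← (IsFractionRing.injective R F).eq_iff, h1, map_zero, smul_eq_zero]
    simp [he0]
  rw [hpow, ← Module.forall_dual_apply_eq_zero_iff F]
  intro φ
  obtain ⟨w, hw⟩ := hφ φ
  rw [hw]
  refine key r _ w (hinf.mono fun m hm => ?_) t
  have hm' : b (r + N * m) = 0 := hm
  rw [Set.mem_ofPred_eq, ← hw, (hpow _).1 hm', map_zero]

/-- The Skolem–Mahler–Lech theorem: the zero set of a linear recurrence sequence over a field of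
characteristic zero is eventually periodic. -/
theorem zeros_eventually_periodic {K : Type*} [Field K] [CharZero K] (a : ℕ → K) (g : K[X])
    (hg : g ≠ 0) (ha : aeval (shift K) g a = 0) :
    ∃ N > 0, ∃ M, ∀ n ≥ M, (a n = 0 ↔ a (n + N) = 0) := by
  obtain ⟨s, hs⟩ := exists_isTranscendenceBasis ℤ K
  let R := MvPolynomial s ℤ
  let : Algebra R K := (MvPolynomial.aeval (R := ℤ) (fun x : s => (x : K))).toAlgebra
  have hinj : Function.Injective (algebraMap R K) := hs.1
  have : FaithfulSMul R K := (faithfulSMul_iff_algebraMap_injective R K).2 hinj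
  have halg : Algebra.IsAlgebraic R K := by
    have := hs.isAlgebraic
    refine Algebra.IsAlgebraic.of_ringHom_of_comp_eq
      (S := Algebra.adjoin ℤ (Set.range ((↑) : s → K))) (B := K) hs.1.aevalEquiv (RingHom.id K) hs.1.aevalEquiv.surjective
      Function.injective_id ?_
    ext x
    · simp
    · simp
      exact (MvPolynomial.aeval_X _ _).symm
  let : Algebra R[X] K[X] := Polynomial.algebra R K
  obtain ⟨h, hh0, q, hq⟩ := (Algebra.IsAlgebraic.isAlgebraic (R := R[X]) g).exists_nonzero_dvd
    (mem_nonZeroDivisors_of_ne_zero hg)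
  have hh : aeval (shift K) (h.map (algebraMap R K)) a = 0 := by
    have : h.map (algebraMap R K) = g * q := hq
    rw [this, mul_comm, map_mul, Module.End.mul_apply, ha, map_zero]
  obtain ⟨f, hf, hXf⟩ := exists_eq_pow_rootMultiplicity_mul_and_not_dvd h hh0 0
  set j := rootMultiplicity 0 h
  rw [C_0, sub_zero] at hf hXf
  have hf0 : f.coeff 0 ≠ 0 := fun h => hXf (X_dvd_iff.2 h)
  obtain ⟨N, hN, key⟩ := exists_period_of_recurrence f hf0 ((shift K ^ j) a) (by
    rw [hf, Polynomial.map_mul, mul_comm, map_mul, Polynomial.map_pow, map_X, map_pow, aeval_X,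
      Module.End.mul_apply] at hh
    exact hh)
  set b := (shift K ^ j) a
  have hM : ∀ r, ∃ M, ∀ m ≥ M, (b (r + N * m) = 0 ↔ b (r + N * (m + 1)) = 0) := by
    intro r
    by_cases hi : {m : ℕ | b (r + N * m) = 0}.Infinite
    · exact ⟨0, fun m _ => by rw [key r hi, key r hi]⟩
    · obtain ⟨M, hM⟩ := (Set.not_infinite.1 hi).bddAbove
      refine ⟨M + 1, fun m hm => iff_of_false (fun h => ?_) (fun h => ?_)⟩
      · have := hM h
        omega
      · have := hM h
        omega
  choose M hM using hM
  refine ⟨N, hN, j + N * (Finset.range N).sup M + N, fun n hn => ?_⟩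
  obtain ⟨n, rfl⟩ : ∃ l, n = l + j := ⟨n - j, by omega⟩
  have h1 := hM (n % N) (n / N) (by
    have : M (n % N) ≤ (Finset.range N).sup M :=
      Finset.le_sup (Finset.mem_range.2 (Nat.mod_lt _ hN))
    refine this.trans ((Nat.le_div_iff_mul_le hN).2 ?_)
    rw [mul_comm]
    omega)
  rw [Nat.mod_add_div, mul_add, mul_one, ← add_assoc, Nat.mod_add_div] at h1
  simp only [b, shift_pow_apply] at h1
  rw [h1]
  have : n + N + j = n + j + N := by omega
  rw [this]

/-- Pairing a sequence with a polynomial: shifting the product of power series corresponds to the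
reflected polynomial in the shift operator. -/
theorem coeff_mk_mul_eq_aeval_shift {K : Type*} [Field K] (a : ℕ → K) (Q : K[X]) (D : ℕ)
    (hD : Q.natDegree ≤ D) (n : ℕ) :
    PowerSeries.coeff (n + D) (PowerSeries.mk a * (Q : PowerSeries K)) =
      aeval (shift K) (Q.reflect D) a n := by
  have hdeg : (Q.reflect D).natDegree < D + 1 :=
    Nat.lt_succ_of_le ((natDegree_reflect_le).trans (max_le le_rfl hD))
  rw [aeval_eq_sum_range' hdeg, LinearMap.sum_apply, Finset.sum_apply, PowerSeries.coeff_mul,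
    Finset.Nat.sum_antidiagonal_eq_sum_range_succ_mk, Nat.succ_eq_add_one, add_assoc,
    Finset.sum_range_add, Finset.sum_eq_zero, zero_add]
  · refine Finset.sum_congr rfl fun i hi => ?_
    have hi' : i ≤ D := by simpa [Nat.lt_succ_iff] using hi
    rw [LinearMap.smul_apply, Pi.smul_apply, shift_pow_apply, coeff_reflect, revAt_le hi',
      smul_eq_mul, mul_comm, PowerSeries.coeff_mk, Polynomial.coeff_coe]
    congr 2
    omega
  · intro i hi
    have hi' : i < n := by simpa using hi
    rw [Polynomial.coeff_coe, coeff_eq_zero_of_natDegree_lt (by omega), mul_zero]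

theorem isRational_iff {K : Type*} [Field K] (a : ℕ → K) :
    IsRational a ↔ ∃ g : K[X], g ≠ 0 ∧ aeval (shift K) g a = 0 := by
  constructor
  · rintro ⟨P, Q, hQ, h⟩
    refine ⟨Q.reflect (max Q.natDegree (P.natDegree + 1)), ?_, ?_⟩
    · rw [Ne, reflect_eq_zero_iff]
      rintro rfl
      simp at hQ
    · funext n
      rw [← coeff_mk_mul_eq_aeval_shift a Q _ (le_max_left _ _), h, Polynomial.coeff_coe]
      exact coeff_eq_zero_of_natDegree_lt (by omega)
  · rintro ⟨g, hg, h⟩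
    let Q : K[X] := C g.leadingCoeff⁻¹ * g.reverse
    have hQd : Q.natDegree ≤ g.natDegree :=
      (natDegree_C_mul_le _ _).trans (reverse_natDegree_le g)
    have hQr : Q.reflect g.natDegree = C g.leadingCoeff⁻¹ * g := by
      simp only [Q, reflect_C_mul, reverse, reflect_reflect]
    refine ⟨(PowerSeries.mk a * (Q : PowerSeries K)).trunc g.natDegree, Q, ?_, ?_⟩
    · simp [Q, hg]
    · ext n
      rw [Polynomial.coeff_coe, PowerSeries.coeff_trunc]
      split_ifs with hn
      · rfl
      · obtain ⟨m, rfl⟩ := Nat.exists_eq_add_of_le' (not_lt.1 hn)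
        rw [coeff_mk_mul_eq_aeval_shift a Q _ hQd, hQr, map_mul, Module.End.mul_apply, h, map_zero,
          Pi.zero_apply]

theorem isRational_iff_fg {K : Type*} [Field K] (a : ℕ → K) :
    IsRational a ↔ ∃ V : Submodule K (ℕ → K), V.FG ∧ V.map (shift K) ≤ V ∧ a ∈ V := by
  rw [isRational_iff]
  constructor
  · rintro ⟨g, hg, h⟩
    let φ : K[X] →ₗ[K] (ℕ → K) :=
      (LinearMap.applyₗ a).comp (aeval (R := K) (shift K)).toLinearMap
    have hφ : ∀ p, φ p = aeval (shift K) p a := fun p => rfl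
    refine ⟨LinearMap.range φ, ?_, ?_, ?_⟩
    · have : LinearMap.range φ = (degreeLT K g.natDegree).map φ := by
        refine le_antisymm ?_ (LinearMap.map_le_range)
        rintro _ ⟨p, rfl⟩
        refine ⟨p % g, ?_, ?_⟩
        · rw [SetLike.mem_coe, mem_degreeLT, ← degree_eq_natDegree hg]
          exact EuclideanDomain.mod_lt p hg
        · conv_rhs => rw [← EuclideanDomain.mod_add_div p g]
          rw [map_add, hφ (g * (p / g)), mul_comm, map_mul, Module.End.mul_apply, h, map_zero,
            add_zero]
      classical
      rw [this, degreeLT_eq_span_X_pow]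
      exact (Submodule.fg_span (Finset.finite_toSet _)).map _
    · rintro _ ⟨_, ⟨p, rfl⟩, rfl⟩
      exact ⟨X * p, by rw [hφ, map_mul, aeval_X, Module.End.mul_apply, hφ]⟩
    · exact ⟨1, by rw [hφ, map_one, Module.End.one_apply]⟩
  · rintro ⟨V, hV, hT, ha⟩
    have : Module.Finite K V := Module.Finite.iff_fg.2 hV
    have hT' : ∀ v ∈ V, shift K v ∈ V := fun v hv => hT ⟨v, hv, rfl⟩
    let f : Module.End K V := (shift K).restrict hT'
    refine ⟨f.charpoly, f.charpoly_monic.ne_zero, ?_⟩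
    have h1 : ∀ (p : K[X]) (v : V),
        ((aeval f p v : V) : ℕ → K) = aeval (shift K) p (v : ℕ → K) := by
      intro p
      induction p using Polynomial.induction_on' with
      | add p q hp hq => intro v; simp [hp, hq]
      | monomial n c =>
        intro v
        rw [aeval_monomial, aeval_monomial]
        simp only [Module.End.mul_apply, Module.algebraMap_end_apply, Submodule.coe_smul]
        congr 1
        induction n generalizing v with
        | zero => simp
        | succ n ih => rw [pow_succ, Module.End.mul_apply, ih, pow_succ, Module.End.mul_apply]; rfl
    rw [← h1 _ ⟨a, ha⟩, LinearMap.aeval_self_charpoly]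
    rfl

namespace IsRational

variable {K : Type*} [Field K]

theorem add {a b : ℕ → K} (ha : IsRational a) (hb : IsRational b) : IsRational (a + b) := by
  rw [isRational_iff] at *
  obtain ⟨g, hg, hga⟩ := ha
  obtain ⟨h, hh, hhb⟩ := hb
  refine ⟨g * h, mul_ne_zero hg hh, ?_⟩
  have hga' : aeval (LampAlg.shift K) (g * h) a = 0 := by
    rw [mul_comm, map_mul, Module.End.mul_apply, hga, map_zero]
  rw [map_add, hga', map_mul, Module.End.mul_apply, hhb, map_zero, zero_add]

theorem mul {a b : ℕ → K} (ha : IsRational a) (hb : IsRational b) : IsRational (a * b) := by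
  rw [isRational_iff_fg] at *
  obtain ⟨V, hV, hVT, hVa⟩ := ha
  obtain ⟨W, hW, hWT, hWb⟩ := hb
  refine ⟨V * W, hV.mul hW, ?_, Submodule.mul_mem_mul hVa hWb⟩
  rw [Submodule.map_le_iff_le_comap, Submodule.mul_le]
  intro v hv w hw
  rw [Submodule.mem_comap]
  exact Submodule.mul_mem_mul (hVT ⟨v, hv, rfl⟩) (hWT ⟨w, hw, rfl⟩)

theorem of_shift_pow {a : ℕ → K} (D : ℕ) (h : IsRational ((shift K ^ D) a)) : IsRational a := by
  rw [isRational_iff] at *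
  obtain ⟨g, hg, hga⟩ := h
  exact ⟨g * X ^ D, mul_ne_zero hg (pow_ne_zero _ X_ne_zero), by
    rw [map_mul, map_pow, aeval_X, Module.End.mul_apply, hga]⟩

theorem aeval_shift {a : ℕ → K} (h : IsRational a) (p : K[X]) :
    IsRational (aeval (shift K) p a) := by
  rw [isRational_iff] at *
  obtain ⟨g, hg, hga⟩ := h
  refine ⟨g, hg, ?_⟩
  rw [← Module.End.mul_apply, ← map_mul, mul_comm, map_mul, Module.End.mul_apply, hga, map_zero]

theorem shift {a : ℕ → K} (h : IsRational a) : IsRational (shift K a) := by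
  simpa using h.aeval_shift X

theorem of_periodic {a : ℕ → K} {N : ℕ} (hN : 0 < N) (h : ∀ n, a (n + N) = a n) :
    IsRational a := by
  rw [isRational_iff]
  refine ⟨X ^ N - 1, (monic_X_pow_sub_C 1 hN.ne').ne_zero, ?_⟩
  funext n
  simp [shift_pow_apply, h]

theorem const (c : K) : IsRational (fun _ : ℕ => c) := of_periodic one_pos fun _ => rfl

theorem neg {a : ℕ → K} (ha : IsRational a) : IsRational (-a) := by
  have := (const (-1 : K)).mul ha
  convert this using 1
  funext n
  simp

theorem single_zero : IsRational (Pi.single 0 1 : ℕ → K) := by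
  apply of_shift_pow 1
  convert const (0 : K) using 1
  funext n
  simp

theorem partialSum {b : ℕ → K} (hb : IsRational b) :
    IsRational fun n => ∑ i ∈ Finset.range (n + 1), b i := by
  have h1 := hb.shift
  rw [isRational_iff] at *
  obtain ⟨g, hg, hgb⟩ := h1
  refine ⟨g * (X - 1), mul_ne_zero hg (X_sub_C_ne_zero 1), ?_⟩
  rw [map_mul, Module.End.mul_apply, ← hgb]
  congr 1
  funext n
  simp [Finset.sum_range_succ _ (n + 1)]

theorem convolution {a b : ℕ → K} (ha : IsRational a) (hb : IsRational b) :
    IsRational fun n => ∑ i ∈ Finset.range (n + 1), a i * b (n - i) := by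
  obtain ⟨P, Q, hQ, h⟩ := ha
  obtain ⟨P', Q', hQ', h'⟩ := hb
  refine ⟨P * P', Q * Q', by simp [mul_coeff_zero, hQ, hQ'], ?_⟩
  have : (PowerSeries.mk fun n => ∑ i ∈ Finset.range (n + 1), a i * b (n - i)) =
      PowerSeries.mk a * PowerSeries.mk b := by
    ext n
    rw [PowerSeries.coeff_mul, Finset.Nat.sum_antidiagonal_eq_sum_range_succ_mk]
    simp
  rw [this, Polynomial.coe_mul, Polynomial.coe_mul, ← h, ← h']
  ring

theorem map {a : ℕ → K} (ha : IsRational a) (σ : K →+* K) : IsRational fun n => σ (a n) := by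
  obtain ⟨P, Q, hQ, h⟩ := ha
  refine ⟨P.map σ, Q.map σ, by simp [hQ], ?_⟩
  rw [Polynomial.polynomial_map_coe, Polynomial.polynomial_map_coe, ← h, map_mul]
  congr 1

/-- rational solutions of linear equations over the ring of power series. -/
theorem exists_mul_eq {c : ℕ → K} (hc : IsRational c) (f : K[X]) (hf : f.coeff 0 ≠ 0) :
    ∃ d, IsRational d ∧ PowerSeries.mk d * (f : PowerSeries K) = PowerSeries.mk c := by
  obtain ⟨P, Q, hQ, h⟩ := hc
  have hf' : PowerSeries.constantCoeff (f : PowerSeries K) ≠ 0 := by simpa using hf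
  refine ⟨fun n => PowerSeries.coeff n (PowerSeries.mk c * (f : PowerSeries K)⁻¹), ?_, ?_⟩
  · refine ⟨C (f.coeff 0)⁻¹ * P, C (f.coeff 0)⁻¹ * f * Q, by simp [mul_coeff_zero, hQ, hf], ?_⟩
    rw [Polynomial.coe_mul, Polynomial.coe_mul, Polynomial.coe_mul, ← h]
    have : (PowerSeries.mk fun n => PowerSeries.coeff n (PowerSeries.mk c * (f : PowerSeries K)⁻¹))
      = PowerSeries.mk c * (f : PowerSeries K)⁻¹ := by ext; simp
    rw [this]
    calc _ = ((C (f.coeff 0)⁻¹ : K[X]) : PowerSeries K) * PowerSeries.mk c * Q *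
          ((f : PowerSeries K) * (f : PowerSeries K)⁻¹) := by ring
      _ = _ := by rw [PowerSeries.mul_inv_cancel _ hf']; ring
  · have : (PowerSeries.mk fun n => PowerSeries.coeff n (PowerSeries.mk c * (f : PowerSeries K)⁻¹))
      = PowerSeries.mk c * (f : PowerSeries K)⁻¹ := by ext; simp
    rw [this, mul_assoc, PowerSeries.inv_mul_cancel _ hf', mul_one]

theorem exists_aeval_shift_eq {c : ℕ → K} (hc : IsRational c) (f : K[X]) (hf : f ≠ 0) :
    ∃ d, IsRational d ∧ aeval (LampAlg.shift K) f d = c := by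
  set D := f.natDegree
  have h1 : IsRational (fun n => if n < D then 0 else c (n - D)) := by
    apply of_shift_pow D
    convert hc using 1
    funext n
    simp [shift_pow_apply]
  obtain ⟨d, hd, h⟩ := h1.exists_mul_eq f.reverse (by simpa using hf)
  refine ⟨d, hd, ?_⟩
  funext n
  have h2 := coeff_mk_mul_eq_aeval_shift d f.reverse D (reverse_natDegree_le f) n
  rw [h, PowerSeries.coeff_mk, reverse, reflect_reflect] at h2
  simpa using h2.symm

theorem zeros_indicator [CharZero K] {a : ℕ → K} (ha : IsRational a) [DecidablePred (a · = 0)] :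
    IsRational (fun n => if a n = 0 then (1 : K) else 0) := by
  obtain ⟨g, hg, hga⟩ := (isRational_iff a).1 ha
  obtain ⟨N, hN, M, h⟩ := zeros_eventually_periodic a g hg hga
  apply of_shift_pow M
  refine of_periodic hN fun n => ?_
  rw [shift_pow_apply, shift_pow_apply]
  have := h (n + M) (by omega)
  rw [add_right_comm]
  exact if_congr this.symm rfl rfl

end IsRational

theorem IsRational.mem_Qset {K : Type*} [Field K] {a : ℕ → K} (ha : IsRational a) : a ∈ Qset K :=
  ⟨a, fun _ => 1, ha, .const 1, fun _ => one_ne_zero, by simp⟩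

/-- The ring `𝓠` of quotients of rational sequences. -/
def Qring (K : Type*) [Field K] : Subring (ℕ → K) where
  carrier := Qset K
  mul_mem' := by
    rintro _ _ ⟨a, b, ha, hb, hb0, rfl⟩ ⟨c, d, hc, hd, hd0, rfl⟩
    refine ⟨a * c, b * d, ha.mul hc, hb.mul hd, fun n => mul_ne_zero (hb0 n) (hd0 n), ?_⟩
    funext n
    simp only [Pi.mul_apply, mul_inv]
    ring
  one_mem' := (IsRational.const 1).mem_Qset
  add_mem' := by
    rintro _ _ ⟨a, b, ha, hb, hb0, rfl⟩ ⟨c, d, hc, hd, hd0, rfl⟩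
    refine ⟨a * d + c * b, b * d, (ha.mul hd).add (hc.mul hb), hb.mul hd,
      fun n => mul_ne_zero (hb0 n) (hd0 n), ?_⟩
    funext n
    have := hb0 n
    have := hd0 n
    simp only [Pi.mul_apply, Pi.add_apply]
    field_simp
  zero_mem' := (IsRational.const 0).mem_Qset
  neg_mem' := by
    rintro _ ⟨a, b, ha, hb, hb0, rfl⟩
    refine ⟨-a, b, ha.neg, hb, hb0, ?_⟩
    funext n
    simp

theorem mem_Qring {K : Type*} [Field K] {q : ℕ → K} : q ∈ Qring K ↔ q ∈ Qset K := Iff.rfl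

theorem IsRational.mem_Qring {K : Type*} [Field K] {a : ℕ → K} (ha : IsRational a) :
    a ∈ Qring K := ha.mem_Qset

theorem map_mem_Qring {K : Type*} [Field K] (σ : K →+* K) {q : ℕ → K} (hq : q ∈ Qring K) :
    (fun n => σ (q n)) ∈ Qring K := by
  obtain ⟨a, b, ha, hb, hb0, rfl⟩ := hq
  exact ⟨_, _, ha.map σ, hb.map σ, fun n => by simpa using hb0 n, by simp⟩

/-- `𝓠` is von Neumann regular. -/
theorem Qring_regular {K : Type*} [Field K] [CharZero K] (q : Qring K) :
    ∃ x : Qring K, q * x * q = q := by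
  classical
  obtain ⟨_, a, b, ha, hb, hb0, rfl⟩ := q
  have hχ := ha.zeros_indicator
  have hmem : (fun n => b n * (if a n = 0 then 0 else 1) *
      (a n + if a n = 0 then 1 else 0)⁻¹) ∈ Qset K := by
    refine ⟨b * (1 + -fun n => if a n = 0 then 1 else 0), a + fun n => if a n = 0 then 1 else 0,
      hb.mul ((IsRational.const 1).add hχ.neg), ha.add hχ, fun n => ?_, ?_⟩
    · by_cases h : a n = 0 <;> simp [h]
    · funext n
      by_cases h : a n = 0 <;> simp [h]
  refine ⟨⟨_, hmem⟩, Subtype.ext ?_⟩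
  funext n
  have := hb0 n
  by_cases h : a n = 0
  · simp [h]
  · simp only [Subring.coe_mul, Pi.mul_apply, h, if_false]
    field_simp
    simp [h]

theorem exists_linearEquiv_quasiInverse {F V : Type*} [Field F] [AddCommGroup V] [Module F V]
    [FiniteDimensional F V] (f : Module.End F V) :
    ∃ g : V ≃ₗ[F] V, f * g.toLinearMap * f = f := by
  obtain ⟨h, hh⟩ := f.rangeRestrict.exists_rightInverse_of_surjective f.range_rangeRestrict
  have hh' : ∀ x, f.rangeRestrict (h x) = x := fun x => LinearMap.congr_fun hh x
  have hinj : Function.Injective h := fun x y hxy => by rw [← hh' x, hxy, hh']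
  obtain ⟨g, hg⟩ := Submodule.exists_linearEquiv_restrict_eq (LinearEquiv.ofInjective h hinj)
  refine ⟨g, LinearMap.ext fun v => ?_⟩
  have h1 := hg ⟨f v, v, rfl⟩
  rw [Module.End.mul_apply, Module.End.mul_apply, LinearEquiv.coe_coe, ← h1]
  exact congrArg Subtype.val (hh' ⟨f v, v, rfl⟩)

/-- Corners of endomorphism rings of finite dimensional spaces are unit-regular. -/
theorem end_corner_unitRegular {F V : Type*} [Field F] [AddCommGroup V] [Module F V]
    [FiniteDimensional F V] (e y : Module.End F V) (he : e * e = e) (hy : e * y * e = y) :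
    ∃ u w : Module.End F V, e * u * e = u ∧ e * w * e = w ∧ u * w = e ∧ w * u = e ∧
      y * u * y = y := by
  let π : V →ₗ[F] LinearMap.range e := e.rangeRestrict
  let ι : LinearMap.range e →ₗ[F] V := (LinearMap.range e).subtype
  have hιπ : ∀ v, ι (π v) = e v := fun v => rfl
  have hee : ∀ v, e (e v) = e v := fun v => LinearMap.congr_fun he v
  have heι : ∀ r, e (ι r) = ι r := by
    rintro ⟨_, v, rfl⟩
    exact hee v
  have hπι : ∀ r, π (ι r) = r := fun r => Subtype.ext (heι r)
  have hπe : ∀ v, π (e v) = π v := fun v => Subtype.ext (hee v)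
  have hyv : ∀ v, e (y (e v)) = y v := fun v => LinearMap.congr_fun hy v
  obtain ⟨g, hg⟩ := exists_linearEquiv_quasiInverse (π ∘ₗ y ∘ₗ ι)
  have hgv : ∀ r, π (y (ι (g (π (y (ι r)))))) = π (y (ι r)) := fun r => LinearMap.congr_fun hg r
  refine ⟨ι ∘ₗ g.toLinearMap ∘ₗ π, ι ∘ₗ g.symm.toLinearMap ∘ₗ π, ?_, ?_, ?_, ?_, ?_⟩ <;>
    refine LinearMap.ext fun v => ?_
  · simp [heι, hπe]
  · simp [heι, hπe]
  · simp [hπι, hιπ]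
  · simp [hπι, hιπ]
  · have hye : ∀ v, e (y v) = y v := fun v => by rw [← hyv v, hee]
    have hye' : ∀ v, y (e v) = y v := fun v => by
      have := hyv (e v)
      rw [hee, hyv] at this
      exact this.symm
    have := congrArg ι (hgv (π v))
    simp only [hιπ, hye, hye'] at this
    exact this

theorem matrix_field_corner_unitRegular {F n : Type*} [Field F] [Fintype n] [DecidableEq n]
    (E y : Matrix n n F) (hE : E * E = E) (hy : E * y * E = y) :
    ∃ u w : Matrix n n F, E * u * E = u ∧ E * w * E = w ∧ u * w = E ∧ w * u = E ∧
      y * u * y = y := by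
  let φ : Matrix n n F ≃ₐ[F] Module.End F (n → F) := Matrix.toLinAlgEquiv'
  obtain ⟨u, w, h1, h2, h3, h4, h5⟩ := end_corner_unitRegular (φ E) (φ y)
    (by rw [← map_mul, hE]) (by rw [← map_mul, ← map_mul, hy])
  refine ⟨φ.symm u, φ.symm w, ?_, ?_, ?_, ?_, ?_⟩ <;> apply φ.injective <;>
    simpa only [map_mul, AlgEquiv.apply_symm_apply]

theorem exists_idempotent_generator {Q : Type*} [CommRing Q] (hQ : ∀ q : Q, ∃ x, q * x * q = q)
    (q : Q) : ∃ ε, ε * ε = ε ∧ ε * q = q ∧ q ∣ ε := by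
  obtain ⟨x, hx⟩ := hQ q
  exact ⟨q * x, by rw [← mul_assoc, hx], hx, dvd_mul_right _ _⟩

/-- Over a commutative von Neumann regular ring, corners of matrix rings are unit-regular. -/
theorem matrix_corner_unitRegular {Q n : Type*} [CommRing Q] [Fintype n] [DecidableEq n]
    (hQ : ∀ q : Q, ∃ x, q * x * q = q)
    (E y : Matrix n n Q) (hE : E * E = E) (hy : E * y * E = y) :
    ∃ u w : Matrix n n Q, E * u * E = u ∧ E * w * E = w ∧ u * w = E ∧ w * u = E ∧
      y * u * y = y := by
  let Φ : Matrix n n Q → Matrix n n Q → Fin 5 → Matrix n n Q := fun u w =>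
    ![E * u * E - u, E * w * E - w, u * w - E, w * u - E, y * u * y - y]
  let J : Ideal Q :=
    { carrier := {q | ∃ u w, ∀ i, q • Φ u w i = 0}
      zero_mem' := ⟨0, 0, fun i => zero_smul _ _⟩
      smul_mem' := by
        rintro c q ⟨u, w, h⟩
        exact ⟨u, w, fun i => by rw [smul_assoc, h, smul_zero]⟩
      add_mem' := by
        rintro p q ⟨u, w, h⟩ ⟨u', w', h'⟩
        obtain ⟨ε, hε, hεp, r, hr⟩ := exists_idempotent_generator hQ p
        have hε' : (1 - ε) * (1 - ε) = 1 - ε := by linear_combination hε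
        have hεε : ε * (1 - ε) = 0 := by linear_combination -hε
        have glue : ∀ i, Φ (ε • u + (1 - ε) • u') (ε • w + (1 - ε) • w') i =
            ε • Φ u w i + (1 - ε) • Φ u' w' i := by
          have hmul : ∀ a b c d : Matrix n n Q,
              (ε • a + (1 - ε) • b) * (ε • c + (1 - ε) • d) = ε • (a * c) + (1 - ε) • (b * d) := by
            intro a b c d
            simp only [add_mul, mul_add, smul_mul_smul_comm, hε, hε', hεε, mul_comm (1 - ε) ε,
              zero_smul, add_zero, zero_add]
          have hone : ∀ a : Matrix n n Q, a = ε • a + (1 - ε) • a := fun a => by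
            rw [← add_smul, add_sub_cancel, one_smul]
          have hsub : ∀ a b c d : Matrix n n Q,
              (ε • a + (1 - ε) • b) - (ε • c + (1 - ε) • d) = ε • (a - c) + (1 - ε) • (b - d) := by
            intro a b c d
            simp only [smul_sub]
            abel
          intro i
          fin_cases i
          · change E * _ * E - _ = _
            conv_lhs => rw [hone E, hmul, hmul, hsub]
            rfl
          · change E * _ * E - _ = _
            conv_lhs => rw [hone E, hmul, hmul, hsub]
            rfl
          · change _ * _ - E = _
            conv_lhs => rw [hone E, hmul, hsub]
            rfl
          · change _ * _ - E = _
            conv_lhs => rw [hone E, hmul, hsub]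
            rfl
          · change y * _ * y - y = _
            conv_lhs => rw [hone y, hmul, hmul, hsub]
            rfl
        refine ⟨ε • u + (1 - ε) • u', ε • w + (1 - ε) • w', fun i => ?_⟩
        have h1 : ε • Φ u w i = 0 := by rw [hr, mul_comm, mul_smul, h, smul_zero]
        rw [glue, h1, zero_add, smul_smul]
        have : (p + q) * (1 - ε) = (1 - ε) * q := by linear_combination -hεp
        rw [this, mul_smul, h', smul_zero] }
  suffices hJ : J = ⊤ by
    obtain ⟨u, w, h⟩ : (1 : Q) ∈ J := hJ ▸ Submodule.mem_top
    simp only [one_smul] at h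
    exact ⟨u, w, sub_eq_zero.1 (h 0), sub_eq_zero.1 (h 1), sub_eq_zero.1 (h 2),
      sub_eq_zero.1 (h 3), sub_eq_zero.1 (h 4)⟩
  by_contra hJ
  obtain ⟨m, hm, hJm⟩ := Ideal.exists_le_maximal J hJ
  let _ : Field (Q ⧸ m) := Ideal.Quotient.field m
  let π : Matrix n n Q →+* Matrix n n (Q ⧸ m) := (Ideal.Quotient.mk m).mapMatrix
  have hπ : Function.Surjective π := fun A =>
    ⟨A.map (Function.surjInv Ideal.Quotient.mk_surjective), by
      ext i j
      exact Function.surjInv_eq _ _⟩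
  obtain ⟨u, w, h1, h2, h3, h4, h5⟩ := matrix_field_corner_unitRegular (π E) (π y)
    (by rw [← map_mul, hE]) (by rw [← map_mul, ← map_mul, hy])
  obtain ⟨u, rfl⟩ := hπ u
  obtain ⟨w, rfl⟩ := hπ w
  have hΦ : ∀ t : Fin 5 × n × n, Φ u w t.1 t.2.1 t.2.2 ∈ m := by
    rintro ⟨i, j, k⟩
    rw [← Ideal.Quotient.eq_zero_iff_mem]
    have : π (Φ u w i) = 0 := by
      fin_cases i
      · change π (E * u * E - u) = 0
        simp only [map_sub, map_mul, h1, sub_self]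
      · change π (E * w * E - w) = 0
        simp only [map_sub, map_mul, h2, sub_self]
      · change π (u * w - E) = 0
        simp only [map_sub, map_mul, h3, sub_self]
      · change π (w * u - E) = 0
        simp only [map_sub, map_mul, h4, sub_self]
      · change π (y * u * y - y) = 0
        simp only [map_sub, map_mul, h5, sub_self]
    exact congrFun (congrFun this j) k
  choose ε _ hεq hεd using exists_idempotent_generator hQ
  let δ : Q := ∏ t : Fin 5 × n × n, (1 - ε (Φ u w t.1 t.2.1 t.2.2))
  have hδJ : δ ∈ J := by
    refine ⟨u, w, fun i => ?_⟩
    ext j k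
    obtain ⟨r, hr⟩ := Finset.dvd_prod_of_mem
      (fun t : Fin 5 × n × n => 1 - ε (Φ u w t.1 t.2.1 t.2.2)) (Finset.mem_univ (i, j, k))
    rw [Matrix.smul_apply, smul_eq_mul, Matrix.zero_apply]
    change (∏ t : Fin 5 × n × n, (1 - ε (Φ u w t.1 t.2.1 t.2.2))) * _ = 0
    rw [hr]
    linear_combination -r * hεq (Φ u w i j k)
  have hδ := hJm hδJ
  obtain ⟨t, -, ht⟩ := (hm.isPrime.prod_mem_iff).1 hδ
  have : ε (Φ u w t.1 t.2.1 t.2.2) ∈ m := m.mem_of_dvd (hεd _) (hΦ t)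
  exact hm.ne_top ((Ideal.eq_top_iff_one m).2 (by simpa using add_mem ht this))

/-- Gluing a unit of a corner `z R z` with the complementary idempotent `1 - z`. -/
theorem unitRegular_of_corner {R : Type*} [Ring R] {z u w y c : R} (hz : z * z = z)
    (hzu : z * u = u) (huz : u * z = u) (hzw : z * w = w) (hwz : w * z = w)
    (hzy : z * y = y) (hyz : y * z = y) (huw : u * w = z) (hwu : w * u = z) (hyuy : y * u * y = y)
    (hc : c = 0 ∨ c = 1) :
    (1 - z + u) * (1 - z + w) = 1 ∧ (1 - z + w) * (1 - z + u) = 1 ∧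
      (c * (1 - z) + y) * (1 - z + u) * (c * (1 - z) + y) = c * (1 - z) + y := by
  have hyu : y * (u * y) = y := by rw [← mul_assoc, hyuy]
  refine ⟨?_, ?_, ?_⟩
  · simp only [add_mul, mul_add, sub_mul, mul_sub, one_mul, mul_one, hz, hzw, huz, huw]
    abel
  · simp only [add_mul, mul_add, sub_mul, mul_sub, one_mul, mul_one, hz, hzu, hwz, hwu]
    abel
  · have h1 : y * (1 - z) = 0 := by rw [mul_sub, hyz, mul_one, sub_self]
    have h2 : (1 - z) * y = 0 := by rw [sub_mul, hzy, one_mul, sub_self]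
    have h3 : u * (1 - z) = 0 := by rw [mul_sub, huz, mul_one, sub_self]
    have h4 : (1 - z) * u = 0 := by rw [sub_mul, hzu, one_mul, sub_self]
    have h5 : (1 - z) * (1 - z) = 1 - z := by rw [mul_sub, mul_one, sub_mul, hz]; simp
    rcases hc with rfl | rfl
    · simp only [zero_mul, zero_add, mul_add, h1, hyuy]
    · simp only [one_mul, mul_add, add_mul, h1, h2, h3, h4, h5, mul_assoc, mul_zero, hyu,
        add_zero, zero_add]

/-- If `S : M → R` is multiplicative for the product of `M` twisted by `G`, and corners of `M` are
unit-regular, then so are elements of the form `c + S T` with `c` equal to `0` or `1`. -/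
theorem unitRegular_of_twisted {R M : Type*} [Ring R] [Ring M]
    (hM : ∀ E y : M, E * E = E → E * y * E = y →
      ∃ u w, E * u * E = u ∧ E * w * E = w ∧ u * w = E ∧ w * u = E ∧ y * u * y = y)
    (S : M →+ R) (G H : M) (hG : G * H * G = G) (hS : ∀ x y, S x * S y = S (x * G * y))
    (hl : ∀ x, S (H * G * x) = S x) (hr : ∀ x, S (x * (G * H)) = S x)
    (c : R) (hc : c = 0 ∨ c = 1) (T : M) :
    ∃ x y : M, (1 - S H + S x) * (1 - S H + S y) = 1 ∧ (1 - S H + S y) * (1 - S H + S x) = 1 ∧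
      (c + S T) * (1 - S H + S x) * (c + S T) = c + S T := by
  obtain ⟨d, hd, hdc⟩ : ∃ d : M, (d = 0 ∨ d = 1) ∧ c * S H = S (d * H) := by
    rcases hc with rfl | rfl
    · exact ⟨0, .inl rfl, by simp⟩
    · exact ⟨1, .inr rfl, by simp⟩
  have hdcomm : ∀ x, d * x = x * d := by rcases hd with rfl | rfl <;> simp
  let E := H * G
  have hE : E * E = E := by simp only [E, mul_assoc, ← mul_assoc G, hG]
  have hGE : G * E = G := by simp only [E, ← mul_assoc, hG]
  have hθ : ∀ x y, S (x * H) * S (y * H) = S (x * E * y * H) := fun x y => by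
    rw [hS]
    simp only [E, mul_assoc]
  have hθ1 : S (E * H) = S H := hl H
  have hθl : ∀ {x}, E * x * E = x → S H * S (x * H) = S (x * H) := fun {x} hx => by
    rw [hS, mul_assoc, ← mul_assoc, ← mul_assoc (H * G)]
    change S (E * x * H) = _
    rw [← hx]
    simp only [← mul_assoc, hE]
  have hθr : ∀ {x}, E * x * E = x → S (x * H) * S H = S (x * H) := fun {x} hx => by
    rw [hS]
    have : x * H * G * H = x * E * H := by simp only [E, mul_assoc]
    rw [this, ← hx]
    simp only [mul_assoc, hE]
  have hy : E * (d * E + E * T * G) * E = d * E + E * T * G := by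
    rw [mul_add, add_mul, ← mul_assoc E d, ← hdcomm]
    simp only [mul_assoc, hGE, hE, ← mul_assoc E E]
  obtain ⟨u, w, h1, h2, h3, h4, h5⟩ := hM E (d * E + E * T * G) hE hy
  have huE : u * E = u := by rw [← h1, mul_assoc, hE]
  have hwE : w * E = w := by rw [← h2, mul_assoc, hE]
  have hyE : (d * E + E * T * G) * E = d * E + E * T * G := by
    simp only [add_mul, mul_assoc, hE, hGE]
  refine ⟨u * H, w * H, ?_⟩
  have key : c + S T = c * (1 - S H) + S ((d * E + E * T * G) * H) := by
    have e1 : (d * E + E * T * G) * H = H * G * (d * H) + H * G * (T * (G * H)) := by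
      rw [add_mul, hdcomm E]
      simp only [E, mul_assoc, hdcomm]
    rw [e1, map_add, hl, hl, hr, mul_sub, mul_one, hdc]
    abel
  rw [key]
  refine unitRegular_of_corner ?_ (hθl h1) (hθr h1) (hθl h2) (hθr h2) (hθl hy) (hθr hy) ?_ ?_ ?_ hc
  · rw [hS, hl]
  · rw [hθ, huE, h3, hθ1]
  · rw [hθ, hwE, h4, hθ1]
  · rw [hθ, hθ, hyE, mul_assoc _ u E, huE, h5]

/-- Sequences of column vectors, on which `TProd K` acts. -/
abbrev Col (K : Type*) [Field K] : Type _ := ∀ n : ℕ, Fin (n + 1) → K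

/-- The rank one elements of `TProd K`. -/
def outer {K : Type*} [Field K] (v w : Col K) : TProd K := fun n => Matrix.vecMulVec (v n) (w n)

/-- The componentwise dot product. -/
def dot {K : Type*} [Field K] (v w : Col K) : ℕ → K := fun n => v n ⬝ᵥ w n

/-- Multiplication of columns by sequences. -/
def scale {K : Type*} [Field K] (q : ℕ → K) (v : Col K) : Col K := fun n => q n • v n

open Matrix in
theorem eq_zero_of_conj_mul_self {K : Type*} [Field K] {σ : K →+* K}
    (hpos : ∀ (ι : Type) [Fintype ι] (v : ι → K), ∑ i, σ (v i) * v i = 0 → v = 0)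
    {p q : Type} [Fintype p] (D : Matrix p q K) (h : (D.map σ)ᵀ * D = 0) : D = 0 := by
  ext i j
  have := congrFun (congrFun h j) j
  rw [Matrix.mul_apply] at this
  exact congrFun (hpos p (fun i => D i j) this) i

theorem exists_sum_outer {K : Type*} [Field K] (C : AddSubgroup (Col K)) {t : TProd K}
    (ht : t ∈ AddSubgroup.closure {x | ∃ v ∈ C, ∃ w ∈ C, x = outer v w}) :
    ∃ (m : ℕ) (v w : Fin m → Col K), (∀ i, v i ∈ C) ∧ (∀ i, w i ∈ C) ∧
      t = ∑ i, outer (v i) (w i) := by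
  induction ht using AddSubgroup.closure_induction with
  | mem x hx =>
    obtain ⟨v, hv, w, hw, rfl⟩ := hx
    exact ⟨1, fun _ => v, fun _ => w, fun _ => hv, fun _ => hw, by simp⟩
  | zero => exact ⟨0, fun _ => 0, fun _ => 0, fun _ => zero_mem _, fun _ => zero_mem _, by simp⟩
  | add x y _ _ hx hy =>
    obtain ⟨m, v, w, hv, hw, rfl⟩ := hx
    obtain ⟨m', v', w', hv', hw', rfl⟩ := hy
    refine ⟨m + m', Fin.append v v', Fin.append w w', ?_, ?_, ?_⟩
    · exact fun i => Fin.addCases (fun i => by simpa using hv i) (fun i => by simpa using hv' i) i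
    · exact fun i => Fin.addCases (fun i => by simpa using hw i) (fun i => by simpa using hw' i) i
    · simp [Fin.sum_univ_add]
  | neg x _ hx =>
    obtain ⟨m, v, w, hv, hw, rfl⟩ := hx
    refine ⟨m, fun i => -v i, w, fun i => neg_mem (hv i), hw, ?_⟩
    rw [← Finset.sum_neg_distrib]
    refine Finset.sum_congr rfl fun i _ => ?_
    funext n
    exact (Matrix.neg_vecMulVec _ _).symm

open Matrix in
theorem unitRegular_of_finiteRank {K : Type*} [Field K] [CharZero K] (σ : K →+* K)
    (hσ : ∀ x, σ (σ x) = x)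
    (hpos : ∀ (ι : Type) [Fintype ι] (v : ι → K), ∑ i, σ (v i) * v i = 0 → v = 0)
    (C : AddSubgroup (Col K)) (hdot : ∀ v ∈ C, ∀ w ∈ C, dot v w ∈ Qring K)
    (hscale : ∀ q ∈ Qring K, ∀ v ∈ C, scale q v ∈ C)
    (hC : ∀ v ∈ C, (fun n i => σ (v n i)) ∈ C)
    (A : Subring (TProd K)) (hA : ∀ v ∈ C, ∀ w ∈ C, outer v w ∈ A) {t : TProd K}
    (ht : t ∈ AddSubgroup.closure {x | ∃ v ∈ C, ∃ w ∈ C, x = outer v w})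
    {c : TProd K} (hc : c = 0 ∨ c = 1) :
    ∃ u ∈ A, ∃ v ∈ A, u * v = 1 ∧ v * u = 1 ∧ (c + t) * u * (c + t) = c + t := by
  classical
  obtain ⟨m, v, w, hv, hw, rfl⟩ := exists_sum_outer C ht
  let Z : Fin m ⊕ Fin m → Col K := Sum.elim v fun i n j => σ (w i n j)
  have hZ : ∀ a, Z a ∈ C := by
    rintro (a | a)
    · exact hv a
    · exact hC _ (hw a)
  let Y : Fin m ⊕ Fin m → Col K := fun a n j => σ (Z a n j)
  have hY : ∀ a, Y a ∈ C := fun a => hC _ (hZ a)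
  let ev (n : ℕ) : Qring K →+* K := (Pi.evalRingHom (fun _ : ℕ => K) n).comp (Qring K).subtype
  let Zm (n : ℕ) : Matrix (Fin (n + 1)) (Fin m ⊕ Fin m) K := Matrix.of fun i a => Z a n i
  let Ym (n : ℕ) : Matrix (Fin m ⊕ Fin m) (Fin (n + 1)) K := Matrix.of fun a i => Y a n i
  have hYZ : ∀ n, ((Zm n).map σ)ᵀ = Ym n := fun n => rfl
  have hZY : ∀ n, ((Ym n).map σ)ᵀ = Zm n := fun n => by
    ext i a
    exact hσ _
  let G : Matrix (Fin m ⊕ Fin m) (Fin m ⊕ Fin m) (Qring K) :=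
    Matrix.of fun a b => ⟨dot (Y a) (Z b), hdot _ (hY a) _ (hZ b)⟩
  have hGn : ∀ n, (ev n).mapMatrix G = Ym n * Zm n := fun n => rfl
  obtain ⟨H, -, -, -, -, -, hH⟩ := matrix_corner_unitRegular Qring_regular 1 G (by simp) (by simp)
  have hHn : ∀ n, Ym n * Zm n * (ev n).mapMatrix H * (Ym n * Zm n) = Ym n * Zm n := fun n => by
    rw [← hGn, ← map_mul, ← map_mul, hH]
  have hZG : ∀ n, Zm n * ((ev n).mapMatrix H * (Ym n * Zm n)) = Zm n := fun n => by
    rw [← sub_eq_zero]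
    apply eq_zero_of_conj_mul_self hpos
    have h1 : Ym n * (Zm n * ((ev n).mapMatrix H * (Ym n * Zm n)) - Zm n) = 0 := by
      rw [Matrix.mul_sub, ← Matrix.mul_assoc, ← Matrix.mul_assoc (Ym n * Zm n), hHn, sub_self]
    have h2 : ((Zm n * ((ev n).mapMatrix H * (Ym n * Zm n)) - Zm n).map σ)ᵀ =
        ((((ev n).mapMatrix H * (Ym n * Zm n)).map σ)ᵀ - 1) * Ym n := by
      rw [Matrix.map_sub _ (map_sub σ), Matrix.map_mul, Matrix.transpose_sub, Matrix.transpose_mul,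
        hYZ, Matrix.sub_mul, Matrix.one_mul]
    rw [h2, Matrix.mul_assoc, h1, Matrix.mul_zero]
  have hGY : ∀ n, Ym n * Zm n * (ev n).mapMatrix H * Ym n = Ym n := fun n => by
    rw [← sub_eq_zero]
    have h0 : ((Ym n * Zm n * (ev n).mapMatrix H * Ym n - Ym n).map σ)ᵀ =
        Zm n * (((Ym n * Zm n * (ev n).mapMatrix H).map σ)ᵀ - 1) := by
      rw [Matrix.map_sub _ (map_sub σ), Matrix.map_mul, Matrix.transpose_sub, Matrix.transpose_mul,
        hZY, Matrix.mul_sub, Matrix.mul_one]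
    have h1 : (Ym n * Zm n * (ev n).mapMatrix H * Ym n - Ym n) * Zm n = 0 := by
      rw [Matrix.sub_mul, Matrix.mul_assoc _ (Ym n), hHn, sub_self]
    have h2 : ((Ym n * Zm n * (ev n).mapMatrix H * Ym n - Ym n).map σ)ᵀ = 0 := by
      apply eq_zero_of_conj_mul_self hpos
      rw [h0, Matrix.map_mul, Matrix.transpose_mul]
      have h3 : ((Zm n).map σ)ᵀ = Ym n := rfl
      have h4 : (((((Ym n * Zm n * (ev n).mapMatrix H).map σ)ᵀ - 1).map σ)ᵀ) * Ym n =
          Ym n * Zm n * (ev n).mapMatrix H * Ym n - Ym n := by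
        have : ((((Ym n * Zm n * (ev n).mapMatrix H).map σ)ᵀ - 1).map σ)ᵀ =
            Ym n * Zm n * (ev n).mapMatrix H - 1 := by
          ext i j
          by_cases hij : i = j
          · subst hij
            simp only [Matrix.transpose_apply, Matrix.map_apply, Matrix.sub_apply, map_sub, hσ,
              Matrix.one_apply_eq, map_one]
          · simp only [Matrix.transpose_apply, Matrix.map_apply, Matrix.sub_apply, map_sub, hσ,
              Matrix.one_apply_ne hij, Matrix.one_apply_ne (Ne.symm hij), map_zero]
        rw [this, Matrix.sub_mul, Matrix.one_mul]
      rw [h3, h4, ← Matrix.mul_assoc, h1, Matrix.zero_mul]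
    ext i j
    have := congrFun (congrFun h2 j) i
    exact (map_eq_zero σ).1 this
  let S : Matrix (Fin m ⊕ Fin m) (Fin m ⊕ Fin m) (Qring K) →+ TProd K :=
    { toFun := fun X n => Zm n * (ev n).mapMatrix X * Ym n
      map_zero' := by
        funext n
        rw [map_zero, Matrix.mul_zero, Matrix.zero_mul]
        rfl
      map_add' := fun X X' => by
        funext n
        rw [map_add, Matrix.mul_add, Matrix.add_mul]
        rfl }
  have hSn : ∀ X n, S X n = Zm n * (ev n).mapMatrix X * Ym n := fun X n => rfl
  have hSA : ∀ X, S X ∈ A := fun X => by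
    have : S X = ∑ a, ∑ b, outer (scale (X a b) (Z a)) (Y b) := by
      funext n
      ext i j
      rw [hSn, Matrix.mul_apply]
      simp only [Matrix.mul_apply, Finset.sum_apply, Matrix.sum_apply, outer, scale,
        vecMulVec_apply, Finset.sum_mul]
      rw [Finset.sum_comm]
      refine Finset.sum_congr rfl fun a _ => Finset.sum_congr rfl fun b _ => ?_
      rw [Pi.smul_apply, smul_eq_mul, mul_comm ((X a b : ℕ → K) n)]
      rfl
    rw [this]
    exact sum_mem fun a _ => sum_mem fun b _ =>
      hA _ (hscale _ (X a b).2 _ (hZ a)) _ (hY b)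
  have hmul : ∀ X X', S X * S X' = S (X * G * X') := fun X X' => by
    funext n
    rw [Pi.mul_apply, hSn, hSn, hSn, map_mul, map_mul, hGn]
    simp only [Matrix.mul_assoc]
  have hl : ∀ X, S (H * G * X) = S X := fun X => by
    funext n
    rw [hSn, hSn, map_mul, map_mul, hGn, ← Matrix.mul_assoc, hZG]
  have hr : ∀ X, S (X * (G * H)) = S X := fun X => by
    funext n
    rw [hSn, hSn, map_mul, map_mul, hGn, Matrix.mul_assoc, Matrix.mul_assoc, hGY,
      ← Matrix.mul_assoc]
  let T : Matrix (Fin m ⊕ Fin m) (Fin m ⊕ Fin m) (Qring K) :=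
    Matrix.of fun a b => if ∃ i, a = .inl i ∧ b = .inr i then 1 else 0
  have hT : ∑ i, outer (v i) (w i) = S T := by
    funext n
    ext i j
    rw [hSn, Matrix.mul_apply]
    simp only [Matrix.mul_apply, Finset.sum_apply, Matrix.sum_apply, outer, vecMulVec_apply]
    rw [Fintype.sum_sum_type]
    simp [Zm, Ym, Z, Y, T, apply_ite, hσ]
  obtain ⟨x, y, h1, h2, h3⟩ := unitRegular_of_twisted (matrix_corner_unitRegular Qring_regular) S G
    H hH hmul hl hr c hc T
  rw [hT]
  exact ⟨_, A.add_mem (A.sub_mem A.one_mem (hSA H)) (hSA x), _,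
    A.add_mem (A.sub_mem A.one_mem (hSA H)) (hSA y), h1, h2, h3⟩

section Columns

variable {K : Type*} [Field K]

/-- The action of `TProd K` on columns. -/
def act (a : TProd K) (v : Col K) : Col K := fun n => Matrix.mulVec (a n) (v n)

/-- The columns filled from the top by a sequence. -/
def up (c : ℕ → K) : Col K := fun _ i => c i

/-- The columns filled from the bottom by a sequence. -/
def down (c : ℕ → K) : Col K := fun n i => c (n - i)

/-- Reversal of columns. -/
def rev (v : Col K) : Col K := fun n i => v n i.rev

/-- The first standard basis columns. -/
def e₀ (K : Type*) [Field K] : Col K := up (Pi.single 0 1)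

theorem act_add (a : TProd K) (v w : Col K) : act a (v + w) = act a v + act a w :=
  funext fun _ => Matrix.mulVec_add _ _ _

theorem act_neg (a : TProd K) (v : Col K) : act a (-v) = -act a v :=
  funext fun _ => Matrix.mulVec_neg _ _

theorem act_sub (a : TProd K) (v w : Col K) : act a (v - w) = act a v - act a w :=
  funext fun _ => Matrix.mulVec_sub _ _ _

theorem act_zero (a : TProd K) : act a 0 = 0 := funext fun _ => Matrix.mulVec_zero _

theorem add_act (a b : TProd K) (v : Col K) : act (a + b) v = act a v + act b v :=
  funext fun _ => Matrix.add_mulVec _ _ _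

theorem mul_act (a b : TProd K) (v : Col K) : act (a * b) v = act a (act b v) :=
  funext fun _ => (Matrix.mulVec_mulVec _ _ _).symm

theorem one_act (v : Col K) : act 1 v = v := funext fun _ => Matrix.one_mulVec _

theorem algebraMap_act (r : K) (v : Col K) :
    act (algebraMap K (TProd K) r) v = scale (fun _ => r) v := by
  funext n
  change Matrix.mulVec (algebraMap K (Matrix (Fin (n + 1)) (Fin (n + 1)) K) r) (v n) = r • v n
  rw [Algebra.algebraMap_eq_smul_one, Matrix.smul_mulVec, Matrix.one_mulVec]

theorem act_scale (a : TProd K) (q : ℕ → K) (v : Col K) : act a (scale q v) = scale q (act a v) :=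
  funext fun _ => Matrix.mulVec_smul _ _ _

theorem scale_scale (q r : ℕ → K) (v : Col K) : scale q (scale r v) = scale (q * r) v :=
  funext fun _ => smul_smul _ _ _

theorem one_scale (v : Col K) : scale 1 v = v := funext fun _ => one_smul _ _

theorem rev_rev (v : Col K) : rev (rev v) = v := by
  funext n i
  simp [rev]

theorem rev_up (c : ℕ → K) : rev (up c) = down c := by
  funext n i
  simp only [rev, up, down, Fin.val_rev]
  congr 1
  omega

theorem rev_down (c : ℕ → K) : rev (down c) = up c := by rw [← rev_up, rev_rev]

theorem mul_outer (a : TProd K) (v w : Col K) : a * outer v w = outer (act a v) w :=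
  funext fun _ => Matrix.mul_vecMulVec _ _ _

theorem outer_act (v w x : Col K) : act (outer v w) x = scale (dot w x) v := by
  funext n i
  simp only [act, Matrix.mulVec, outer, scale, dot, dotProduct, Matrix.vecMulVec_apply,
    Pi.smul_apply, smul_eq_mul, Finset.sum_mul]
  exact Finset.sum_congr rfl fun j _ => by ring

theorem outer_mul_outer (v w x y : Col K) :
    outer v w * outer x y = outer (scale (dot w x) v) y := by rw [mul_outer, outer_act]

theorem ψ_mul_outer (q : ℕ → K) (v w : Col K) : ψ q * outer v w = outer (scale q v) w := by
  rw [mul_outer]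
  congr 1
  funext n
  simp only [act, ψ, Matrix.smul_mulVec, Matrix.one_mulVec, scale]

theorem dot_comm (v w : Col K) : dot v w = dot w v := funext fun _ => dotProduct_comm _ _

theorem dot_e₀ (v : Col K) (n : ℕ) : dot (e₀ K) v n = v n 0 := by
  simp only [dot, dotProduct, e₀, up]
  rw [Fin.sum_univ_succ]
  simp

theorem dot_e₀_e₀ : dot (e₀ K) (e₀ K) = 1 := by
  funext n
  rw [dot_e₀]
  simp [e₀, up]

/-- The columns on which `𝓔` acts. -/
def Cols (K : Type*) [Field K] : AddSubgroup (Col K) :=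
  AddSubgroup.closure {x | ∃ q ∈ Qring K, ∃ c, IsRational c ∧
    (x = scale q (up c) ∨ x = scale q (down c))}

theorem scale_up_mem {q c : ℕ → K} (hq : q ∈ Qring K) (hc : IsRational c) :
    scale q (up c) ∈ Cols K := AddSubgroup.subset_closure ⟨q, hq, c, hc, .inl rfl⟩

theorem scale_down_mem {q c : ℕ → K} (hq : q ∈ Qring K) (hc : IsRational c) :
    scale q (down c) ∈ Cols K := AddSubgroup.subset_closure ⟨q, hq, c, hc, .inr rfl⟩

theorem up_mem {c : ℕ → K} (hc : IsRational c) : up c ∈ Cols K := by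
  simpa only [one_scale] using scale_up_mem (Qring K).one_mem hc

theorem down_mem {c : ℕ → K} (hc : IsRational c) : down c ∈ Cols K := by
  simpa only [one_scale] using scale_down_mem (Qring K).one_mem hc

theorem e₀_mem : e₀ K ∈ Cols K := up_mem .single_zero

/-- An additive map on columns compatible with scaling preserves `Cols` as soon as it maps the
generators there. -/
theorem mem_Cols_of_map {f : Col K →+ Col K} {σ : (ℕ → K) → ℕ → K}
    (hσ : ∀ q ∈ Qring K, σ q ∈ Qring K) (hf : ∀ q v, f (scale q v) = scale (σ q) (f v))
    (hscale : ∀ q ∈ Qring K, ∀ v ∈ Cols K, scale q v ∈ Cols K)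
    (hu : ∀ c, IsRational c → f (up c) ∈ Cols K) (hd : ∀ c, IsRational c → f (down c) ∈ Cols K)
    {v : Col K} (hv : v ∈ Cols K) : f v ∈ Cols K := by
  induction hv using AddSubgroup.closure_induction with
  | mem x hx =>
    obtain ⟨q, hq, c, hc, rfl | rfl⟩ := hx
    · rw [hf]
      exact hscale _ (hσ q hq) _ (hu c hc)
    · rw [hf]
      exact hscale _ (hσ q hq) _ (hd c hc)
  | zero => rw [map_zero]; exact zero_mem _
  | add x y _ _ hx hy => rw [map_add]; exact add_mem hx hy
  | neg x _ hx => rw [map_neg]; exact neg_mem hx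

theorem scale_mem {q : ℕ → K} (hq : q ∈ Qring K) {v : Col K} (hv : v ∈ Cols K) :
    scale q v ∈ Cols K := by
  have hadd : ∀ x y : Col K, scale q (x + y) = scale q x + scale q y :=
    fun x y => funext fun _ => smul_add _ _ _
  induction hv using AddSubgroup.closure_induction with
  | mem x hx =>
    obtain ⟨r, hr, c, hc, rfl | rfl⟩ := hx
    · rw [scale_scale]
      exact scale_up_mem ((Qring K).mul_mem hq hr) hc
    · rw [scale_scale]
      exact scale_down_mem ((Qring K).mul_mem hq hr) hc
  | zero =>
    convert (Cols K).zero_mem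
    exact funext fun _ => smul_zero _
  | add x y _ _ hx hy => rw [hadd]; exact add_mem hx hy
  | neg x _ hx =>
    convert neg_mem hx using 1
    exact funext fun _ => smul_neg _ _

theorem rev_mem {v : Col K} (hv : v ∈ Cols K) : rev v ∈ Cols K :=
  mem_Cols_of_map (f := { toFun := rev, map_zero' := rfl, map_add' := fun _ _ => rfl }) (σ := id)
    (fun _ h => h) (fun _ _ => rfl) (fun _ hq _ hv => scale_mem hq hv)
    (fun c hc => show rev (up c) ∈ Cols K from (rev_up c).symm ▸ down_mem hc)
    (fun c hc => show rev (down c) ∈ Cols K from (rev_down c).symm ▸ up_mem hc) hv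

theorem conj_mem (σ : K →+* K) {v : Col K} (hv : v ∈ Cols K) :
    (fun n i => σ (v n i)) ∈ Cols K :=
  mem_Cols_of_map (σ := fun q n => σ (q n))
    (f :=
      { toFun := fun v n i => σ (v n i)
        map_zero' := funext fun _ => funext fun _ => map_zero σ
        map_add' := fun _ _ => funext fun _ => funext fun _ => map_add σ _ _ })
    (fun _ h => map_mem_Qring σ h) (fun q v => by ext; simp [scale])
    (fun _ hq _ hv => scale_mem hq hv)
    (fun c hc => up_mem (hc.map σ)) (fun c hc => down_mem (hc.map σ)) hv

theorem act_mem_of_generators {a : TProd K} (hu : ∀ c, IsRational c → act a (up c) ∈ Cols K)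
    (hd : ∀ c, IsRational c → act a (down c) ∈ Cols K) {v : Col K} (hv : v ∈ Cols K) :
    act a v ∈ Cols K :=
  mem_Cols_of_map (σ := id)
    (f := { toFun := act a, map_zero' := act_zero a, map_add' := act_add a })
    (fun _ h => h) (act_scale a) (fun _ hq _ hv => scale_mem hq hv) hu hd hv

theorem dot_mem {v w : Col K} (hv : v ∈ Cols K) (hw : w ∈ Cols K) : dot v w ∈ Qring K := by
  have hsc : ∀ (q r : ℕ → K) (x y : Col K), dot (scale q x) (scale r y) = q * r * dot x y := by
    intro q r x y
    funext n
    simp only [dot, scale, smul_dotProduct, dotProduct_smul, smul_eq_mul, Pi.mul_apply]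
    ring
  have huu : ∀ c d, IsRational c → IsRational d → dot (up c) (up d) ∈ Qring K := by
    intro c d hc hd
    convert (hc.mul hd).partialSum.mem_Qring using 1
    funext n
    simp only [dot, dotProduct, up]
    exact Fin.sum_univ_eq_sum_range (fun i => c i * d i) (n + 1)
  have hud : ∀ c d, IsRational c → IsRational d → dot (up c) (down d) ∈ Qring K := by
    intro c d hc hd
    convert (hc.convolution hd).mem_Qring using 1
    funext n
    simp only [dot, dotProduct, up, down]
    exact Fin.sum_univ_eq_sum_range (fun i => c i * d (n - i)) (n + 1)
  have hdd : ∀ c d, IsRational c → IsRational d → dot (down c) (down d) ∈ Qring K := by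
    intro c d hc hd
    convert huu c d hc hd using 1
    funext n
    rw [← rev_up, ← rev_up]
    exact Equiv.sum_comp Fin.revPerm fun i => up c n i * up d n i
  induction hv, hw using AddSubgroup.closure_induction₂ with
  | mem x y hx hy =>
    obtain ⟨q, hq, c, hc, rfl | rfl⟩ := hx <;> obtain ⟨r, hr, d, hd, rfl | rfl⟩ := hy <;>
      rw [hsc] <;> refine (Qring K).mul_mem ((Qring K).mul_mem hq hr) ?_
    · exact huu c d hc hd
    · exact hud c d hc hd
    · rw [dot_comm]
      exact hud d c hd hc
    · exact hdd c d hc hd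
  | zero_left x _ =>
    convert (Qring K).zero_mem
    exact funext fun _ => zero_dotProduct _
  | zero_right x _ =>
    convert (Qring K).zero_mem
    exact funext fun _ => dotProduct_zero _
  | add_left x y z _ _ _ h1 h2 =>
    convert (Qring K).add_mem h1 h2
    exact funext fun _ => add_dotProduct _ _ _
  | add_right x y z _ _ _ h1 h2 =>
    convert (Qring K).add_mem h1 h2
    exact funext fun _ => dotProduct_add _ _ _
  | neg_left x y _ _ h =>
    convert (Qring K).neg_mem h
    exact funext fun _ => neg_dotProduct _ _
  | neg_right x y _ _ h =>
    convert (Qring K).neg_mem h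
    exact funext fun _ => dotProduct_neg _ _

end Columns

section Generators

variable {K : Type*} [Field K]

theorem sT_apply (n : ℕ) (i j : Fin (n + 1)) :
    sT K n i j = if (i : ℕ) = j + 1 then 1 else 0 := rfl

theorem sT_act_zero (v : Col K) (n : ℕ) : act (sT K) v n 0 = 0 := by
  simp [act, Matrix.mulVec, dotProduct, sT_apply]

theorem sT_act_succ (v : Col K) (n : ℕ) (i : Fin n) :
    act (sT K) v n i.succ = v n i.castSucc := by
  simp only [act, Matrix.mulVec, dotProduct, sT_apply, Fin.val_succ, Nat.add_right_cancel_iff]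
  rw [Finset.sum_eq_single i.castSucc]
  · simp
  · intro j _ hj
    rw [if_neg, zero_mul]
    intro h
    exact hj (Fin.ext h.symm)
  · simp

theorem sT_act_up (F : PowerSeries K) :
    act (sT K) (up fun n => PowerSeries.coeff n F) =
      up fun n => PowerSeries.coeff n (PowerSeries.X * F) := by
  funext n i
  refine Fin.cases ?_ (fun i => ?_) i
  · rw [sT_act_zero]
    simp [up]
  · rw [sT_act_succ]
    simp [up, PowerSeries.coeff_succ_X_mul]

theorem aeval_sT_act_up (f : K[X]) (F : PowerSeries K) :
    act (aeval (sT K) f) (up fun n => PowerSeries.coeff n F) =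
      up fun n => PowerSeries.coeff n ((f : PowerSeries K) * F) := by
  induction f using Polynomial.induction_on generalizing F with
  | C a =>
    rw [aeval_C, algebraMap_act]
    funext n i
    simp [scale, up]
  | add f g hf hg =>
    rw [map_add, add_act, hf, hg]
    funext n i
    simp [up, add_mul]
  | monomial n a h =>
    rw [pow_succ, ← mul_assoc, map_mul, aeval_X, mul_act, sT_act_up, h, Polynomial.coe_mul _ X,
      Polynomial.coe_X, mul_assoc]

theorem aeval_sT_act_up_of_mul_eq {f : K[X]} {c d : ℕ → K}
    (h : PowerSeries.mk d * (f : PowerSeries K) = PowerSeries.mk c) :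
    act (aeval (sT K) f) (up d) = up c := by
  have := aeval_sT_act_up f (PowerSeries.mk d)
  rw [mul_comm, h] at this
  simpa only [PowerSeries.coeff_mk] using this

theorem sT_act_down (c : ℕ → K) :
    act (sT K) (down c) = down (shift K c) - scale (shift K c) (e₀ K) := by
  funext n i
  refine Fin.cases ?_ (fun i => ?_) i
  · rw [sT_act_zero]
    simp [down, scale, e₀, up]
  · rw [sT_act_succ]
    have : n - (i + 1) + 1 = n - i := by omega
    simp [down, scale, e₀, up, this]

theorem one_sub_sT_mul_sstarT : 1 - sT K * sstarT K = outer (e₀ K) (e₀ K) := by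
  funext n
  ext i j
  have h : (sT K * sstarT K) n i j = ∑ l, sT K n i l * sT K n j l := rfl
  change (1 : Matrix _ _ K) i j - (sT K * sstarT K) n i j = _
  rw [h]
  have h0 : e₀ K n 0 = 1 := by simp [e₀, up]
  have hs : ∀ l : Fin n, e₀ K n l.succ = 0 := fun l => by simp [e₀, up]
  change _ = e₀ K n i * e₀ K n j
  refine Fin.cases ?_ (fun i => ?_) i
  · have h1 : ∀ l, sT K n 0 l = 0 := fun l => by
      rw [sT_apply, if_neg (by simp)]
    rw [Finset.sum_eq_zero fun l _ => by rw [h1, zero_mul], h0, one_mul, sub_zero]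
    refine Fin.cases ?_ (fun j => ?_) j
    · rw [h0, Matrix.one_apply_eq]
    · rw [hs, Matrix.one_apply_ne (Fin.succ_ne_zero j).symm]
  · rw [hs, zero_mul, sub_eq_zero, Finset.sum_eq_single i.castSucc]
    · simp [sT_apply, Matrix.one_apply, Fin.ext_iff, eq_comm]
    · intro l _ hl
      rw [sT_apply, if_neg, zero_mul]
      intro h
      exact hl (Fin.ext (by simpa using h.symm))
    · simp

theorem sT_pow_apply (n k : ℕ) (i j : Fin (n + 1)) :
    (sT K n ^ k) i j = if (i : ℕ) = j + k then 1 else 0 := by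
  induction k generalizing j with
  | zero => simp [Matrix.one_apply, Fin.ext_iff]
  | succ k ih =>
    rw [pow_succ, Matrix.mul_apply]
    simp only [ih]
    by_cases hj : (j : ℕ) + 1 < n + 1
    · rw [Finset.sum_eq_single ⟨j + 1, hj⟩]
      · simp only [sT_apply, if_true, mul_one]
        congr 1
        simp only [eq_iff_iff]
        omega
      · intro l _ hl
        rw [sT_apply, if_neg (fun h => hl (Fin.ext h)), mul_zero]
      · simp
    · rw [if_neg (by omega)]
      refine Finset.sum_eq_zero fun l _ => ?_
      have hl : (l : ℕ) ≠ j + 1 := by omega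
      rw [sT_apply, if_neg hl, mul_zero]

theorem isUnit_aeval_sT {f : K[X]} (hf : f.coeff 0 = 1) : IsUnit (aeval (sT K) f) := by
  rw [Pi.isUnit_iff]
  intro n
  have h1 : aeval (sT K) f n = aeval (sT K n) f :=
    (aeval_algHom_apply (Pi.evalAlgHom K (fun n => Matrix (Fin (n + 1)) (Fin (n + 1)) K) n)
      (sT K) f).symm
  have h2 : aeval (sT K n) f = 1 + sT K n * aeval (sT K n) f.divX := by
    conv_lhs => rw [← f.X_mul_divX_add]
    rw [hf, map_add, map_mul, aeval_X, map_one, map_one]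
    exact add_comm _ _
  have h3 : IsNilpotent (sT K n) := by
    refine ⟨n + 1, ?_⟩
    ext i j
    rw [sT_pow_apply, if_neg (by omega)]
    rfl
  have h4 : Commute (sT K n) (aeval (sT K n) f.divX) := by
    have := Commute.all X f.divX
    have := this.map (aeval (sT K n))
    rwa [aeval_X] at this
  rw [h1, h2]
  exact (h4.isNilpotent_mul_right h3).isUnit_one_add

/-- Simultaneous reversal of rows and columns. -/
def revT (K : Type*) [Field K] : TProd K ≃ₐ[K] TProd K :=
  AlgEquiv.piCongrRight fun _ => Matrix.reindexAlgEquiv K K Fin.revPerm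

theorem revT_apply (a : TProd K) (n : ℕ) (i j : Fin (n + 1)) :
    revT K a n i j = a n i.rev j.rev := rfl

theorem revT_sT : revT K (sT K) = sstarT K := by
  funext n
  ext i j
  have : n - (i : ℕ) = n - j + 1 ↔ (j : ℕ) = i + 1 := by omega
  simp [revT_apply, sstarT, sT_apply, this]

theorem revT_sstarT : revT K (sstarT K) = sT K := by
  rw [← revT_sT]
  funext n
  ext i j
  simp [revT_apply]

theorem revT_outer (v w : Col K) : revT K (outer v w) = outer (rev v) (rev w) := rfl

theorem revT_act (a : TProd K) (v : Col K) : act (revT K a) v = rev (act a (rev v)) := by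
  funext n i
  simp only [act, rev, Matrix.mulVec, dotProduct, revT_apply]
  exact (Equiv.sum_comp Fin.revPerm fun j => a n i.rev j * v n j.rev).symm.trans
    (by simp) |>.symm

theorem revT_aeval_sT (f : K[X]) : revT K (aeval (sT K) f) = aeval (sstarT K) f := by
  rw [← revT_sT]
  exact (aeval_algHom_apply (revT K).toAlgHom _ _).symm

theorem isUnit_aeval_sstarT {f : K[X]} (hf : f.coeff 0 = 1) : IsUnit (aeval (sstarT K) f) := by
  rw [← revT_aeval_sT]
  exact (isUnit_aeval_sT hf).map (revT K)

theorem one_sub_sstarT_mul_sT : 1 - sstarT K * sT K = outer (rev (e₀ K)) (rev (e₀ K)) := by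
  rw [← revT_outer, ← one_sub_sT_mul_sstarT, map_sub, map_mul, map_one, revT_sT, revT_sstarT]

theorem inverse_revT {a : TProd K} (ha : IsUnit a) :
    Ring.inverse (revT K a) = revT K (Ring.inverse a) :=
  Ring.inverse_unit ⟨revT K a, revT K (Ring.inverse a),
    by rw [← map_mul, Ring.mul_inverse_cancel _ ha, map_one],
    by rw [← map_mul, Ring.inverse_mul_cancel _ ha, map_one]⟩

/-- Componentwise transposition. -/
def tr (a : TProd K) : TProd K := fun n => (a n).transpose

theorem tr_mul (a b : TProd K) : tr (a * b) = tr b * tr a :=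
  funext fun _ => Matrix.transpose_mul _ _

theorem tr_add (a b : TProd K) : tr (a + b) = tr a + tr b := rfl

theorem tr_tr (a : TProd K) : tr (tr a) = a := rfl

theorem tr_outer (v w : Col K) : tr (outer v w) = outer w v :=
  funext fun _ => Matrix.transpose_vecMulVec _ _

theorem tr_algebraMap (r : K) : tr (algebraMap K (TProd K) r) = algebraMap K (TProd K) r := by
  funext n
  change (algebraMap K (Matrix (Fin (n + 1)) (Fin (n + 1)) K) r).transpose =
    algebraMap K (Matrix (Fin (n + 1)) (Fin (n + 1)) K) r
  rw [Algebra.algebraMap_eq_smul_one, Matrix.transpose_smul, Matrix.transpose_one]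

theorem tr_aeval (a : TProd K) (f : K[X]) : tr (aeval a f) = aeval (tr a) f := by
  induction f using Polynomial.induction_on with
  | C r => rw [aeval_C, aeval_C, tr_algebraMap]
  | add f g hf hg => rw [map_add, map_add, tr_add, hf, hg]
  | monomial n r h =>
    rw [pow_succ, ← mul_assoc, map_mul, aeval_X, tr_mul, h, mul_comm _ X, map_mul _ X,
      aeval_X]

theorem tr_one : tr (1 : TProd K) = 1 := funext fun _ => Matrix.transpose_one

theorem inverse_tr {a : TProd K} (ha : IsUnit a) : Ring.inverse (tr a) = tr (Ring.inverse a) :=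
  Ring.inverse_unit ⟨tr a, tr (Ring.inverse a),
    by rw [← tr_mul, Ring.inverse_mul_cancel _ ha, tr_one],
    by rw [← tr_mul, Ring.mul_inverse_cancel _ ha, tr_one]⟩

theorem outer_mul (v w : Col K) (a : TProd K) : outer v w * a = outer v (act (tr a) w) := by
  rw [← tr_tr (outer v w * a), tr_mul, tr_outer, mul_outer, tr_outer]

end Generators

section Algebra

variable {K : Type*} [Field K]

theorem sT_mem : sT K ∈ Ealg K := Algebra.subset_adjoin (.inl (.inl (.inl rfl)))

theorem sstarT_mem : sstarT K ∈ Ealg K := Algebra.subset_adjoin (.inl (.inl (.inr rfl)))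

theorem aeval_sT_mem (f : K[X]) : aeval (sT K) f ∈ Ealg K :=
  Algebra.adjoin_le (Set.singleton_subset_iff.2 sT_mem) (aeval_mem_adjoin_singleton K _)

theorem aeval_sstarT_mem (f : K[X]) : aeval (sstarT K) f ∈ Ealg K :=
  Algebra.adjoin_le (Set.singleton_subset_iff.2 sstarT_mem) (aeval_mem_adjoin_singleton K _)

theorem inverse_aeval_sT_mem {f : K[X]} (hf : f.coeff 0 = 1) :
    Ring.inverse (aeval (sT K) f) ∈ Ealg K :=
  Algebra.subset_adjoin (.inl (.inr ⟨f, hf, .inl rfl⟩))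

theorem inverse_aeval_sstarT_mem {f : K[X]} (hf : f.coeff 0 = 1) :
    Ring.inverse (aeval (sstarT K) f) ∈ Ealg K :=
  Algebra.subset_adjoin (.inl (.inr ⟨f, hf, .inr rfl⟩))

theorem outer_scale_e₀_mem {q : ℕ → K} (hq : q ∈ Qring K) :
    outer (scale q (e₀ K)) (e₀ K) ∈ Ealg K :=
  Algebra.subset_adjoin (.inr ⟨q, hq, by rw [one_sub_sT_mul_sstarT, ψ_mul_outer]⟩)

/-- Induction on the generators of `𝓔`. -/
theorem Ealg_induction {p : TProd K → Prop} (hs : p (sT K)) (hs' : p (sstarT K))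
    (hi : ∀ f : K[X], f.coeff 0 = 1 → p (Ring.inverse (aeval (sT K) f)))
    (hi' : ∀ f : K[X], f.coeff 0 = 1 → p (Ring.inverse (aeval (sstarT K) f)))
    (ho : ∀ q ∈ Qring K, p (outer (scale q (e₀ K)) (e₀ K)))
    (hc : ∀ r, p (algebraMap K (TProd K) r))
    (hadd : ∀ a b, a ∈ Ealg K → b ∈ Ealg K → p a → p b → p (a + b))
    (hmul : ∀ a b, a ∈ Ealg K → b ∈ Ealg K → p a → p b → p (a * b)) {a : TProd K}
    (ha : a ∈ Ealg K) : p a := by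
  induction ha using Algebra.adjoin_induction with
  | mem x hx =>
    obtain ((rfl | rfl) | ⟨f, hf, rfl | rfl⟩) | ⟨q, hq, rfl⟩ := hx
    · exact hs
    · exact hs'
    · exact hi f hf
    · exact hi' f hf
    · rw [one_sub_sT_mul_sstarT, ψ_mul_outer]
      exact ho q hq
  | algebraMap r => exact hc r
  | add x y hx hy h1 h2 => exact hadd x y hx hy h1 h2
  | mul x y hx hy h1 h2 => exact hmul x y hx hy h1 h2

theorem tr_sT : tr (sT K) = sstarT K := rfl

theorem tr_mem {a : TProd K} (ha : a ∈ Ealg K) : tr a ∈ Ealg K := by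
  refine Ealg_induction (p := fun a => tr a ∈ Ealg K) sstarT_mem sT_mem ?_ ?_ ?_ ?_ ?_ ?_ ha
  · intro f hf
    rw [← inverse_tr (isUnit_aeval_sT hf), tr_aeval, tr_sT]
    exact inverse_aeval_sstarT_mem hf
  · intro f hf
    rw [← inverse_tr (isUnit_aeval_sstarT hf), tr_aeval, ← tr_sT, tr_tr]
    exact inverse_aeval_sT_mem hf
  · intro q hq
    have : tr (outer (scale q (e₀ K)) (e₀ K)) = outer (scale q (e₀ K)) (e₀ K) := by
      rw [tr_outer]
      exact funext fun n => (Matrix.vecMulVec_smul _ _ _).trans (Matrix.smul_vecMulVec _ _ _).symm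
    rw [this]
    exact outer_scale_e₀_mem hq
  · intro r
    rw [tr_algebraMap]
    exact (Ealg K).algebraMap_mem r
  · exact fun a b _ _ h1 h2 => (Ealg K).add_mem h1 h2
  · intro a b _ _ h1 h2
    rw [tr_mul]
    exact (Ealg K).mul_mem h2 h1

theorem sT_act_mem {v : Col K} (hv : v ∈ Cols K) : act (sT K) v ∈ Cols K := by
  refine act_mem_of_generators (fun c hc => ?_) (fun c hc => ?_) hv
  · have h := sT_act_up (PowerSeries.mk c)
    simp only [PowerSeries.coeff_mk] at h
    rw [h]
    refine up_mem (.of_shift_pow 1 ?_)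
    convert hc using 1
    funext n
    rw [shift_pow_apply, PowerSeries.coeff_succ_X_mul, PowerSeries.coeff_mk]
  · rw [sT_act_down]
    exact sub_mem (down_mem hc.shift) (scale_mem hc.shift.mem_Qring e₀_mem)

/-- The columns filled from the top. -/
def upCols (K : Type*) [Field K] : AddSubgroup (Col K) :=
  AddSubgroup.closure {x | ∃ q ∈ Qring K, ∃ c, IsRational c ∧ x = scale q (up c)}

theorem aeval_sT_act_scale_e₀_mem (f : K[X]) {q : ℕ → K} (hq : q ∈ Qring K) :
    act (aeval (sT K) f) (scale q (e₀ K)) ∈ upCols K := by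
  have h1 : PowerSeries.mk (Pi.single 0 1 : ℕ → K) = 1 := by
    ext n
    rw [PowerSeries.coeff_mk, PowerSeries.coeff_one, Pi.single_apply]
  have h2 := aeval_sT_act_up f (PowerSeries.mk (Pi.single 0 1 : ℕ → K))
  simp only [PowerSeries.coeff_mk] at h2
  rw [act_scale, e₀, h2, h1, mul_one]
  refine AddSubgroup.subset_closure ⟨q, hq, _, ⟨f, 1, by simp, ?_⟩, rfl⟩
  ext n
  simp

theorem aeval_sT_act_down_sub_mem (f : K[X]) {d : ℕ → K} (hd : IsRational d) :
    act (aeval (sT K) f) (down d) - down (aeval (shift K) f d) ∈ upCols K := by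
  induction f using Polynomial.induction_on generalizing d with
  | C a =>
    rw [aeval_C, algebraMap_act, aeval_C, Module.algebraMap_end_apply]
    convert (upCols K).zero_mem
    rw [sub_eq_zero]
    rfl
  | add f g hf hg =>
    have := (upCols K).add_mem (hf hd) (hg hd)
    rw [← add_sub_add_comm, ← add_act, ← map_add] at this
    rw [map_add (aeval (shift K))]
    exact this
  | monomial n a h =>
    rw [pow_succ, ← mul_assoc, map_mul _ _ X, map_mul _ _ X, aeval_X, aeval_X, mul_act, sT_act_down,
      act_sub, Module.End.mul_apply, sub_right_comm]
    exact sub_mem (h hd.shift) (aeval_sT_act_scale_e₀_mem _ hd.shift.mem_Qring)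

theorem inverse_aeval_sT_act_mem {f : K[X]} (hf : f.coeff 0 = 1) {v : Col K} (hv : v ∈ Cols K) :
    act (Ring.inverse (aeval (sT K) f)) v ∈ Cols K := by
  have key : ∀ w, act (Ring.inverse (aeval (sT K) f)) (act (aeval (sT K) f) w) = w := fun w => by
    rw [← mul_act, Ring.inverse_mul_cancel _ (isUnit_aeval_sT hf), one_act]
  have hf0 : f.coeff 0 ≠ 0 := by rw [hf]; exact one_ne_zero
  have hup : ∀ c, IsRational c → act (Ring.inverse (aeval (sT K) f)) (up c) ∈ Cols K := by
    intro c hc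
    obtain ⟨d, hd, h⟩ := hc.exists_mul_eq f hf0
    rw [← aeval_sT_act_up_of_mul_eq h, key]
    exact up_mem hd
  have hupC : ∀ x ∈ upCols K, act (Ring.inverse (aeval (sT K) f)) x ∈ Cols K := by
    intro x hx
    induction hx using AddSubgroup.closure_induction with
    | mem x hx =>
      obtain ⟨q, hq, c, hc, rfl⟩ := hx
      rw [act_scale]
      exact scale_mem hq (hup c hc)
    | zero => rw [act_zero]; exact zero_mem _
    | add x y _ _ hx hy => rw [act_add]; exact add_mem hx hy
    | neg x _ hx => rw [act_neg]; exact neg_mem hx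
  refine act_mem_of_generators hup (fun c hc => ?_) hv
  obtain ⟨d, hd, h⟩ := hc.exists_aeval_shift_eq f (fun h => hf0 (by rw [h, coeff_zero]))
  have h1 := hupC _ (aeval_sT_act_down_sub_mem f hd)
  rw [h, act_sub, key] at h1
  simpa using sub_mem (down_mem hd) h1

theorem act_mem {a : TProd K} (ha : a ∈ Ealg K) {v : Col K} (hv : v ∈ Cols K) :
    act a v ∈ Cols K := by
  refine Ealg_induction (p := fun a => ∀ v ∈ Cols K, act a v ∈ Cols K) ?_ ?_ ?_ ?_ ?_ ?_ ?_ ?_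
    ha v hv
  · exact fun v hv => sT_act_mem hv
  · intro v hv
    rw [← revT_sT, revT_act]
    exact rev_mem (sT_act_mem (rev_mem hv))
  · exact fun f hf v hv => inverse_aeval_sT_act_mem hf hv
  · intro f hf v hv
    rw [← revT_aeval_sT, inverse_revT (isUnit_aeval_sT hf), revT_act]
    exact rev_mem (inverse_aeval_sT_act_mem hf (rev_mem hv))
  · intro q hq v hv
    rw [outer_act]
    exact scale_mem (dot_mem e₀_mem hv) (scale_mem hq e₀_mem)
  · intro r v hv
    rw [algebraMap_act]
    exact scale_mem (IsRational.const r).mem_Qring hv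
  · intro a b _ _ h1 h2 v hv
    rw [add_act]
    exact add_mem (h1 v hv) (h2 v hv)
  · intro a b _ _ h1 h2 v hv
    rw [mul_act]
    exact h1 _ (h2 v hv)

theorem exists_act_e₀_eq_up {c : ℕ → K} (hc : IsRational c) :
    ∃ a ∈ Ealg K, revT K a ∈ Ealg K ∧ act a (e₀ K) = up c := by
  obtain ⟨P, Q, hQ, h⟩ := hc
  refine ⟨Ring.inverse (aeval (sT K) Q) * aeval (sT K) P,
    mul_mem (inverse_aeval_sT_mem hQ) (aeval_sT_mem P), ?_, ?_⟩
  · rw [map_mul, ← inverse_revT (isUnit_aeval_sT hQ), revT_aeval_sT, revT_aeval_sT]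
    exact mul_mem (inverse_aeval_sstarT_mem hQ) (aeval_sstarT_mem P)
  · have h1 : act (aeval (sT K) P) (e₀ K) = act (aeval (sT K) Q) (up c) := by
      have h0 : PowerSeries.mk (Pi.single 0 1 : ℕ → K) = 1 := by
        ext n
        rw [PowerSeries.coeff_mk, PowerSeries.coeff_one, Pi.single_apply]
      rw [aeval_sT_act_up_of_mul_eq (c := fun n => P.coeff n) (d := c)]
      · apply aeval_sT_act_up_of_mul_eq
        rw [h0, one_mul]
        ext n
        simp
      · rw [h]
        ext n
        simp
    rw [mul_act, h1, ← mul_act, Ring.inverse_mul_cancel _ (isUnit_aeval_sT hQ), one_act]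

theorem outer_rev_e₀_e₀_mem : outer (rev (e₀ K)) (e₀ K) ∈ Ealg K := by
  obtain ⟨a, ha, -, h⟩ := exists_act_e₀_eq_up (IsRational.const (1 : K))
  have h1 : outer (up fun _ => 1) (e₀ K) ∈ Ealg K := by
    rw [← h, ← mul_outer]
    refine mul_mem ha ?_
    simpa only [one_scale] using outer_scale_e₀_mem (Qring K).one_mem
  have h2 : outer (rev (e₀ K)) (rev (e₀ K)) ∈ Ealg K := by
    rw [← one_sub_sstarT_mul_sT]
    exact sub_mem (one_mem _) (mul_mem sstarT_mem sT_mem)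
  have h3 := mul_mem h2 h1
  have h4 : dot (rev (e₀ K)) (up fun _ => 1) = 1 := by
    funext n
    have : dot (rev (e₀ K)) (up fun _ => 1) n = dot (e₀ K) (up fun _ => 1) n :=
      Equiv.sum_comp Fin.revPerm fun i => e₀ K n i * 1
    rw [this, dot_e₀]
    rfl
  rwa [outer_mul_outer, h4, one_scale] at h3

theorem outer_e₀_mem {v : Col K} (hv : v ∈ Cols K) : outer v (e₀ K) ∈ Ealg K := by
  induction hv using AddSubgroup.closure_induction with
  | mem x hx =>
    obtain ⟨q, hq, c, hc, rfl | rfl⟩ := hx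
    · obtain ⟨a, ha, -, h⟩ := exists_act_e₀_eq_up hc
      rw [← h, ← act_scale, ← mul_outer]
      exact mul_mem ha (outer_scale_e₀_mem hq)
    · obtain ⟨a, -, ha, h⟩ := exists_act_e₀_eq_up hc
      have h1 : dot (e₀ K) (scale q (e₀ K)) = q := by
        funext n
        rw [dot_e₀]
        simp [scale, e₀, up]
      have h2 : down c = act (revT K a) (rev (e₀ K)) := by rw [revT_act, rev_rev, h, rev_up]
      have h3 : outer (scale q (rev (e₀ K))) (e₀ K) =
          outer (rev (e₀ K)) (e₀ K) * outer (scale q (e₀ K)) (e₀ K) := by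
        rw [outer_mul_outer, h1]
      rw [h2, ← act_scale, ← mul_outer, h3]
      exact mul_mem ha (mul_mem outer_rev_e₀_e₀_mem (outer_scale_e₀_mem hq))
  | zero =>
    convert (Ealg K).zero_mem
    exact funext fun _ => Matrix.zero_vecMulVec _
  | add x y _ _ hx hy =>
    convert add_mem hx hy
    exact funext fun _ => Matrix.add_vecMulVec _ _ _
  | neg x _ hx =>
    convert neg_mem hx
    exact funext fun _ => Matrix.neg_vecMulVec _ _

theorem outer_mem {v w : Col K} (hv : v ∈ Cols K) (hw : w ∈ Cols K) : outer v w ∈ Ealg K := by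
  have h := mul_mem (outer_e₀_mem hv) (tr_mem (outer_e₀_mem hw))
  rwa [tr_outer, outer_mul_outer, dot_e₀_e₀, one_scale] at h

end Algebra

section FiniteRank

variable {K : Type*} [Field K]

/-- The ideal of `𝓔` consisting of the elements of uniformly bounded rank. -/
def finiteRank (K : Type*) [Field K] : AddSubgroup (TProd K) :=
  AddSubgroup.closure {x | ∃ v ∈ Cols K, ∃ w ∈ Cols K, x = outer v w}

theorem outer_mem_finiteRank {v w : Col K} (hv : v ∈ Cols K) (hw : w ∈ Cols K) :
    outer v w ∈ finiteRank K := AddSubgroup.subset_closure ⟨v, hv, w, hw, rfl⟩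

theorem mul_mem_finiteRank {a : TProd K} (ha : a ∈ Ealg K) {x : TProd K}
    (hx : x ∈ finiteRank K) : a * x ∈ finiteRank K := by
  induction hx using AddSubgroup.closure_induction with
  | mem x hx =>
    obtain ⟨v, hv, w, hw, rfl⟩ := hx
    rw [mul_outer]
    exact outer_mem_finiteRank (act_mem ha hv) hw
  | zero => rw [mul_zero]; exact zero_mem _
  | add x y _ _ hx hy => rw [mul_add]; exact add_mem hx hy
  | neg x _ hx => rw [mul_neg]; exact neg_mem hx

theorem finiteRank_mul_mem {a : TProd K} (ha : a ∈ Ealg K) {x : TProd K}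
    (hx : x ∈ finiteRank K) : x * a ∈ finiteRank K := by
  induction hx using AddSubgroup.closure_induction with
  | mem x hx =>
    obtain ⟨v, hv, w, hw, rfl⟩ := hx
    rw [outer_mul]
    exact outer_mem_finiteRank hv (act_mem (tr_mem ha) hw)
  | zero => rw [zero_mul]; exact zero_mem _
  | add x y _ _ hx hy => rw [add_mul]; exact add_mem hx hy
  | neg x _ hx => rw [neg_mul]; exact neg_mem hx

theorem sT_mul_sstarT_sub_one_mem : sT K * sstarT K - 1 ∈ finiteRank K := by
  rw [← neg_sub, one_sub_sT_mul_sstarT]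
  exact neg_mem (outer_mem_finiteRank e₀_mem e₀_mem)

theorem sT_pow_mul_sstarT_pow_sub_one_mem (n : ℕ) :
    sT K ^ n * sstarT K ^ n - 1 ∈ finiteRank K := by
  induction n with
  | zero => simp
  | succ n ih =>
    have h : sT K ^ (n + 1) * sstarT K ^ (n + 1) - 1 =
        sT K * (sT K ^ n * sstarT K ^ n - 1) * sstarT K + (sT K * sstarT K - 1) := by
      rw [pow_succ', pow_succ]
      noncomm_ring
    rw [h]
    exact add_mem (finiteRank_mul_mem sstarT_mem (mul_mem_finiteRank sT_mem ih))
      sT_mul_sstarT_sub_one_mem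

/-- Modulo the elements of finite rank, a polynomial in `s*` times a power of `s` is a polynomial
in `s`. -/
theorem exists_aeval_sub_sT_pow_mul_mem {f : K[X]} (hf : f.coeff 0 ≠ 0) :
    ∃ (D : ℕ) (g : K[X]), g ≠ 0 ∧
      aeval (sT K) g - sT K ^ D * aeval (sstarT K) f ∈ finiteRank K := by
  refine ⟨f.natDegree,
    ∑ i ∈ Finset.range (f.natDegree + 1), C (f.coeff i) * X ^ (f.natDegree - i), ?_, ?_⟩
  · intro h
    apply hf
    have h1 := congrArg (fun g => g.coeff f.natDegree) h
    simp only [finsetSum_coeff, coeff_C_mul_X_pow, coeff_zero] at h1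
    rw [Finset.sum_eq_single 0] at h1
    · simpa using h1
    · intro i hi h0
      rw [if_neg]
      have := Finset.mem_range.1 hi
      omega
    · simp
  · rw [aeval_eq_sum_range (p := f), map_sum, Finset.mul_sum, ← Finset.sum_sub_distrib]
    refine sum_mem fun i hi => ?_
    obtain ⟨j, hj⟩ := Nat.exists_eq_add_of_le' (Nat.le_of_lt_succ (Finset.mem_range.1 hi))
    have h : aeval (sT K) (C (f.coeff i) * X ^ (f.natDegree - i)) -
        sT K ^ f.natDegree * f.coeff i • sstarT K ^ i =
        -(aeval (sT K) (C (f.coeff i) * X ^ j) * (sT K ^ i * sstarT K ^ i - 1)) := by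
      rw [hj, Nat.add_sub_cancel, map_mul, aeval_C, map_pow, aeval_X, pow_add,
        Algebra.smul_def, mul_sub, mul_one, neg_sub, ← mul_assoc _ (algebraMap _ _ _),
        ← Algebra.commutes]
      simp only [mul_assoc]
    rw [h]
    exact neg_mem (mul_mem_finiteRank (aeval_sT_mem _) (sT_pow_mul_sstarT_pow_sub_one_mem i))

/-- Modulo the elements of finite rank, every element of `𝓔` is a fraction in `s`. -/
theorem exists_aeval_mul_sub_aeval_mem {a : TProd K} (ha : a ∈ Ealg K) :
    ∃ f : K[X], f ≠ 0 ∧ ∃ g : K[X],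
      aeval (sT K) f * a - aeval (sT K) g ∈ finiteRank K := by
  refine Ealg_induction (p := fun a => ∃ f : K[X], f ≠ 0 ∧ ∃ g : K[X],
    aeval (sT K) f * a - aeval (sT K) g ∈ finiteRank K) ?_ ?_ ?_ ?_ ?_ ?_ ?_ ?_ ha
  · exact ⟨1, one_ne_zero, X, by simp⟩
  · exact ⟨X, X_ne_zero, 1, by simpa using sT_mul_sstarT_sub_one_mem⟩
  · intro f hf
    refine ⟨f, fun h => by simp [h] at hf, 1, ?_⟩
    rw [Ring.mul_inverse_cancel _ (isUnit_aeval_sT hf), map_one, sub_self]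
    exact zero_mem _
  · intro f hf
    obtain ⟨D, g, hg, h⟩ := exists_aeval_sub_sT_pow_mul_mem (f := f) (by simp [hf])
    refine ⟨g, hg, X ^ D, ?_⟩
    have h1 := finiteRank_mul_mem (inverse_aeval_sstarT_mem hf) h
    rwa [sub_mul, mul_assoc, Ring.mul_inverse_cancel _ (isUnit_aeval_sstarT hf), mul_one,
      ← aeval_X_pow (R := K)] at h1
  · intro q hq
    refine ⟨1, one_ne_zero, 0, ?_⟩
    rw [map_one, one_mul, map_zero, sub_zero]
    exact outer_mem_finiteRank (scale_mem hq e₀_mem) e₀_mem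
  · exact fun r => ⟨1, one_ne_zero, C r, by simp⟩
  · rintro a b - - ⟨f, hf, g, h⟩ ⟨f', hf', g', h'⟩
    refine ⟨f * f', mul_ne_zero hf hf', f' * g + f * g', ?_⟩
    have h1 := add_mem (mul_mem_finiteRank (aeval_sT_mem f') h)
      (mul_mem_finiteRank (aeval_sT_mem f) h')
    convert h1 using 1
    have h2 := (Commute.all f f').map (aeval (sT K))
    rw [map_add, map_mul, map_mul, map_mul, mul_add, mul_sub, mul_sub]
    nth_rw 1 [h2.eq]
    simp only [mul_assoc]
    abel
  · rintro a b - hb ⟨f, hf, g, h⟩ ⟨f', hf', g', h'⟩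
    refine ⟨f' * f, mul_ne_zero hf' hf, g * g', ?_⟩
    have h1 := add_mem (finiteRank_mul_mem hb (mul_mem_finiteRank (aeval_sT_mem f') h))
      (mul_mem_finiteRank (aeval_sT_mem g) h')
    convert h1 using 1
    have h2 := (Commute.all f' g).map (aeval (sT K))
    rw [map_mul, map_mul, mul_sub, mul_sub, sub_mul, h2.eq]
    simp only [mul_assoc]
    abel

theorem sT_mul_outer_rev_e₀ (w : Col K) : sT K * outer (rev (e₀ K)) w = 0 := by
  have h : act (sT K) (rev (e₀ K)) = 0 := by
    rw [e₀, rev_up, sT_act_down]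
    have : shift K (Pi.single 0 1 : ℕ → K) = 0 := by
      funext n
      simp
    rw [this]
    funext n i
    simp [down, scale]
  rw [mul_outer, h]
  exact funext fun _ => Matrix.zero_vecMulVec _

theorem tr_sstarT : tr (sstarT K) = sT K := rfl

theorem tr_zero : tr (0 : TProd K) = 0 := rfl

theorem sstarT_mul_outer_e₀ (w : Col K) : sstarT K * outer (e₀ K) w = 0 := by
  have h := congrArg (revT K) (sT_mul_outer_rev_e₀ (rev w))
  rwa [map_mul, revT_outer, revT_sT, rev_rev, rev_rev, map_zero] at h

theorem outer_rev_e₀_mul_sstarT (v : Col K) : outer v (rev (e₀ K)) * sstarT K = 0 := by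
  rw [← tr_tr (_ * _), tr_mul, tr_outer, tr_sstarT, sT_mul_outer_rev_e₀, tr_zero]

theorem outer_e₀_mul_sT (v : Col K) : outer v (e₀ K) * sT K = 0 := by
  rw [← tr_tr (_ * _), tr_mul, tr_outer, tr_sT, sstarT_mul_outer_e₀, tr_zero]

/-- Nonzero polynomials in `s` lift to units of `𝓔` modulo the elements of finite rank. -/
theorem exists_unit_sub_aeval_mem {f : K[X]} (hf : f ≠ 0) :
    ∃ b ∈ Ealg K, ∃ b' ∈ Ealg K, b * b' = 1 ∧ b' * b = 1 ∧
      b - aeval (sT K) f ∈ finiteRank K := by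
  induction f using Polynomial.recOnHorner with
  | M0 => exact absurd rfl hf
  | MC f r hf0 hr _ =>
    have hg : (C r⁻¹ * (f + C r)).coeff 0 = 1 := by
      simp [hf0, hr]
    have hu := isUnit_aeval_sT hg
    have h1 : aeval (sT K) (f + C r) =
        algebraMap K (TProd K) r * aeval (sT K) (C r⁻¹ * (f + C r)) := by
      rw [map_mul, aeval_C, ← mul_assoc, ← map_mul, mul_inv_cancel₀ hr, map_one, one_mul]
    refine ⟨_, aeval_sT_mem (f + C r),
      Ring.inverse (aeval (sT K) (C r⁻¹ * (f + C r))) * algebraMap K (TProd K) r⁻¹,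
      mul_mem (inverse_aeval_sT_mem hg) ((Ealg K).algebraMap_mem _), ?_, ?_, ?_⟩
    · rw [h1, mul_assoc, ← mul_assoc _ (Ring.inverse _), Ring.mul_inverse_cancel _ hu, one_mul,
        ← map_mul, mul_inv_cancel₀ hr, map_one]
    · rw [h1, mul_assoc, ← mul_assoc _ (algebraMap _ _ r), ← map_mul, inv_mul_cancel₀ hr, map_one,
        one_mul, Ring.inverse_mul_cancel _ hu]
    · rw [sub_self]
      exact zero_mem _
  | MX f hf0 ih =>
    obtain ⟨b, hb, b', hb', h1, h2, h3⟩ := ih hf0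
    have he : rev (e₀ K) ∈ Cols K := rev_mem e₀_mem
    set w := sT K + outer (e₀ K) (rev (e₀ K)) with hw
    set w' := sstarT K + outer (rev (e₀ K)) (e₀ K) with hw'
    have hwm : w ∈ Ealg K := add_mem sT_mem (outer_mem e₀_mem he)
    have hwm' : w' ∈ Ealg K := add_mem sstarT_mem (outer_mem he e₀_mem)
    have hdot : dot (rev (e₀ K)) (rev (e₀ K)) = 1 := by
      rw [← dot_e₀_e₀]
      exact funext fun n => Equiv.sum_comp Fin.revPerm fun i => e₀ K n i * e₀ K n i
    have e1 : w * w' = 1 := by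
      rw [hw, hw', add_mul, mul_add, mul_add, sT_mul_outer_rev_e₀, outer_rev_e₀_mul_sstarT,
        outer_mul_outer, hdot, one_scale, ← one_sub_sT_mul_sstarT]
      abel
    have e2 : w' * w = 1 := by
      rw [hw, hw', add_mul, mul_add, mul_add, sstarT_mul_outer_e₀, outer_e₀_mul_sT,
        outer_mul_outer, dot_e₀_e₀, one_scale, ← one_sub_sstarT_mul_sT]
      abel
    refine ⟨b * w, mul_mem hb hwm, w' * b', mul_mem hwm' hb', ?_, ?_, ?_⟩
    · rw [mul_assoc, ← mul_assoc w, e1, one_mul, h1]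
    · rw [mul_assoc, ← mul_assoc b', h2, one_mul, e2]
    · have h4 : b * w - aeval (sT K) (f * X) =
          (b - aeval (sT K) f) * w + aeval (sT K) f * outer (e₀ K) (rev (e₀ K)) := by
        rw [map_mul, aeval_X, hw]
        noncomm_ring
      rw [h4]
      exact add_mem (finiteRank_mul_mem hwm h3)
        (mul_mem_finiteRank (aeval_sT_mem f) (outer_mem_finiteRank e₀_mem he))

/-- The algebra `𝓔` is unit-regular over any field with a positive definite involution. -/
theorem unitRegular_Ealg [CharZero K] (σ : K →+* K) (hσ : ∀ x, σ (σ x) = x)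
    (hpos : ∀ (ι : Type) [Fintype ι] (v : ι → K), ∑ i, σ (v i) * v i = 0 → v = 0)
    {a : TProd K} (ha : a ∈ Ealg K) :
    ∃ u ∈ Ealg K, ∃ v ∈ Ealg K, u * v = 1 ∧ v * u = 1 ∧ a * u * a = a := by
  have key : ∀ t ∈ finiteRank K, ∀ c : TProd K, c = 0 ∨ c = 1 → ∃ u ∈ Ealg K, ∃ v ∈ Ealg K,
      u * v = 1 ∧ v * u = 1 ∧ (c + t) * u * (c + t) = c + t := fun t ht c hc =>
    unitRegular_of_finiteRank σ hσ hpos (Cols K) (fun v hv w hw => dot_mem hv hw)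
      (fun q hq v hv => scale_mem hq hv) (fun v hv => conj_mem σ hv) (Ealg K).toSubring
      (fun v hv w hw => outer_mem hv hw) ht hc
  obtain ⟨f, hf, g, h⟩ := exists_aeval_mul_sub_aeval_mem ha
  obtain ⟨b, hb, b', hb', h1, h2, h3⟩ := exists_unit_sub_aeval_mem hf
  have h4 : b * a - aeval (sT K) g ∈ finiteRank K := by
    convert add_mem (finiteRank_mul_mem ha h3) h using 1
    noncomm_ring
  by_cases hg : g = 0
  · rw [hg, map_zero, sub_zero] at h4
    have h5 := mul_mem_finiteRank hb' h4
    rw [← mul_assoc, h2, one_mul] at h5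
    simpa only [zero_add] using key a h5 0 (.inl rfl)
  · obtain ⟨d, hd, d', hd', e1, e2, e3⟩ := exists_unit_sub_aeval_mem hg
    have h5 : d' * (b * a) - 1 ∈ finiteRank K := by
      convert mul_mem_finiteRank hd' (sub_mem h4 e3) using 1
      rw [sub_sub_sub_cancel_right, mul_sub, e2]
    obtain ⟨u, hu, v, hv, huv, hvu, h6⟩ := key _ h5 1 (.inr rfl)
    rw [add_sub_cancel] at h6
    have h7 : b' * (d * (d' * (b * a))) = a := by
      rw [← mul_assoc d, e1, one_mul, ← mul_assoc, h2, one_mul]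
    refine ⟨u * (d' * b), mul_mem hu (mul_mem hd' hb), b' * d * v,
      mul_mem (mul_mem hb' hd) hv, ?_, ?_, ?_⟩
    · calc u * (d' * b) * (b' * d * v) = u * (d' * ((b * b') * d) * v) := by
            simp only [mul_assoc]
        _ = 1 := by rw [h1, one_mul, e2, one_mul, huv]
    · calc b' * d * v * (u * (d' * b)) = b' * (d * ((v * u) * d') * b) := by
            simp only [mul_assoc]
        _ = 1 := by rw [hvu, one_mul, e1, one_mul, h2]
    · calc a * (u * (d' * b)) * a
          = b' * (d * (d' * (b * a))) * (u * (d' * b)) * a := by rw [h7]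
        _ = b' * (d * (d' * (b * a) * u * (d' * (b * a)))) := by simp only [mul_assoc]
        _ = a := by rw [h6, h7]

end FiniteRank

/-- A subfield of `ℂ` stable under conjugation carries a positive definite involution. -/
theorem exists_positive_involution (K : Subfield ℂ) (hK : ∀ z ∈ K, (starRingEnd ℂ) z ∈ K) :
    ∃ σ : K →+* K, (∀ x, σ (σ x) = x) ∧
      ∀ (ι : Type) [Fintype ι] (v : ι → K), ∑ i, σ (v i) * v i = 0 → v = 0 := by
  refine ⟨(starRingEnd ℂ).restrict K K hK, fun x => Subtype.ext (Complex.conj_conj _), ?_⟩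
  intro ι _ v h
  have h1 : ∑ i, Complex.normSq (v i) = 0 := by
    have h2 := congrArg (fun x : K => (x : ℂ)) h
    simp only [AddSubmonoidClass.coe_finsetSum, MulMemClass.coe_mul, ZeroMemClass.coe_zero] at h2
    rw [← Complex.ofReal_inj, Complex.ofReal_sum, Complex.ofReal_zero, ← h2]
    exact Finset.sum_congr rfl fun i _ => Complex.normSq_eq_conj_mul_self
  rw [Finset.sum_eq_zero_iff_of_nonneg fun i _ => Complex.normSq_nonneg _] at h1
  exact funext fun i => Subtype.ext (Complex.normSq_eq_zero.1 (h1 i (Finset.mem_univ i)))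

end LampAlg

open LampAlg in
/-- Part of Theorem 6.16 of the paper: the algebra `𝓔` (the *-regular closure of
`k[𝓕]` in `𝓤(G)`) is unit-regular: every `a ∈ 𝓔` satisfies `a·u·a = a` for some unit
`u` of `𝓔`. -/
theorem stmt17 (K : Subfield ℂ) (hK : ∀ z ∈ K, (starRingEnd ℂ) z ∈ K) :
    ∀ a ∈ Ealg K, ∃ u ∈ Ealg K, ∃ v ∈ Ealg K,
      u * v = 1 ∧ v * u = 1 ∧ a * u * a = a := by
  obtain ⟨σ, hσ, hpos⟩ := exists_positive_involution K hK
  exact fun a ha => unitRegular_Ealg σ hσ hpos ha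
end

section
/- In the algebra 𝓓, the two-sided ideal generated by 1 − s·s* coincides with the two-sided ideal generated by 1 − s*·s. Moreover, the quotient ring 𝓓/⟨1 − s·s*⟩ is isomorphic, as a k-algebra, to the rational function field k(x), via an isomorphism under which the class of s corresponds to x and the class of s* corresponds to x⁻¹. -/
set_option synthInstance.maxHeartbeats 1000000
set_option maxHeartbeats 1000000

namespace LampAlg

open Polynomial

/-- the unital `k`-subalgebra `𝓓` of `T''` generated by `s`, `s*` and the inverses
`f(s)⁻¹` and `f(s*)⁻¹` for `f ∈ Σ = {f : f(0) = 1}` (these are units of `T''`, and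
`Ring.inverse` produces their inverses). -/
noncomputable def Dalg (k : Type*) [Field k] : Subalgebra k (TProd k) :=
  Algebra.adjoin k ({sT k, sstarT k} ∪
    {y : TProd k | ∃ p : k[X], p.coeff 0 = 1 ∧
      (y = Ring.inverse (aeval (sT k) p) ∨ y = Ring.inverse (aeval (sstarT k) p))})

end LampAlg

namespace LampAlg

open Polynomial

section Generic

/-- In a ring where `1 - s` and `1 - t` are units, a one-sided inverse relation between `s` and `t`
is two-sided. -/
lemma mul_eq_one_symm_of_isUnit {Q : Type*} [Ring Q] {s t : Q} (h : s * t = 1)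
    (hs : IsUnit (1 - s)) (ht : IsUnit (1 - t)) : t * s = 1 := by
  have hsu : IsUnit s := by
    have h1 : s * (1 - t) = -(1 - s) := by rw [mul_sub, h]; simp
    have h2 : IsUnit (s * (1 - t)) := h1 ▸ hs.neg
    obtain ⟨u, hu⟩ := ht
    rw [← hu] at h2
    exact (Units.isUnit_mul_units s u).1 h2
  obtain ⟨u, rfl⟩ := hsu
  rw [Units.mul_eq_one_iff_inv_eq.1 h |>.symm, Units.inv_mul]

/-- `C` is the whole algebra as soon as it contains `s`, `t` and the inverses of `f(s)`, `f(t)`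
for all polynomials `f` with `f(0) = 1`. -/
def RationallyGenerated (k : Type*) [Field k] {Q : Type*} [Ring Q] [Algebra k Q] (s t : Q) : Prop :=
  ∀ C : Subalgebra k Q, s ∈ C → t ∈ C →
    (∀ p : k[X], p.coeff 0 = 1 → ∀ y : Q, y * aeval s p = 1 → aeval s p * y = 1 → y ∈ C) →
    (∀ p : k[X], p.coeff 0 = 1 → ∀ y : Q, y * aeval t p = 1 → aeval t p * y = 1 → y ∈ C) →
    C = ⊤

variable {k : Type*} [Field k]

lemma RationallyGenerated.map {A B : Type*} [Ring A] [Algebra k A] [Ring B] [Algebra k B]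
    {s t : A} (h : RationallyGenerated k s t) (f : A →ₐ[k] B) (hf : Function.Surjective f) :
    RationallyGenerated k (f s) (f t) := by
  intro C hs ht hys hyt
  have hC : C.comap f = ⊤ := by
    refine h _ hs ht (fun p hp y h1 h2 => hys p hp _ ?_ ?_) (fun p hp y h1 h2 => hyt p hp _ ?_ ?_)
    all_goals
      rw [aeval_algHom_apply, AlgHom.coe_toRingHom, ← map_mul]
      simp only [h1, h2, map_one]
  refine eq_top_iff.2 fun b _ => ?_
  obtain ⟨a, rfl⟩ := hf b
  have : a ∈ C.comap f := hC ▸ Algebra.mem_top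
  exact this

lemma mem_centralizer_of_mul_eq_one {Q : Type*} [Ring Q] [Algebra k Q] {A : Set Q} {u y : Q}
    (hu : u ∈ Subalgebra.centralizer k A) (h1 : y * u = 1) (h2 : u * y = 1) :
    y ∈ Subalgebra.centralizer k A := by
  rw [Subalgebra.mem_centralizer_iff] at hu ⊢
  intro g hg
  calc g * y = y * u * (g * y) := by rw [h1, one_mul]
    _ = y * (u * g) * y := by simp only [mul_assoc]
    _ = y * g * (u * y) := by rw [← hu g hg]; simp only [mul_assoc]
    _ = y * g := by rw [h2, mul_one]

lemma aeval_mem_subalgebra {Q : Type*} [Ring Q] [Algebra k Q] (C : Subalgebra k Q) {s : Q}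
    (hs : s ∈ C) (p : k[X]) : aeval s p ∈ C :=
  Algebra.adjoin_le (Set.singleton_subset_iff.2 hs) (aeval_mem_adjoin_singleton k s)

lemma RationallyGenerated.mul_comm {Q : Type*} [Ring Q] [Algebra k Q] {s t : Q}
    (h : RationallyGenerated k s t) (hst : s * t = 1) (hts : t * s = 1) (a b : Q) :
    a * b = b * a := by
  have key : ∀ A : Set Q, s ∈ Subalgebra.centralizer k A → Subalgebra.centralizer k A = ⊤ := by
    intro A hs
    have ht := mem_centralizer_of_mul_eq_one hs hts hst
    exact h _ hs ht
      (fun p _ y h1 h2 => mem_centralizer_of_mul_eq_one (aeval_mem_subalgebra _ hs p) h1 h2)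
      (fun p _ y h1 h2 => mem_centralizer_of_mul_eq_one (aeval_mem_subalgebra _ ht p) h1 h2)
  have h1 : Subalgebra.centralizer k {s} = ⊤ := key {s} <| by
    rw [Subalgebra.mem_centralizer_iff]; rintro g rfl; rfl
  have h2 : Subalgebra.centralizer k (Set.univ : Set Q) = ⊤ := key _ <| by
    rw [Subalgebra.mem_centralizer_iff]
    intro g _
    have hg : g ∈ Subalgebra.centralizer k {s} := h1 ▸ Algebra.mem_top
    exact (Subalgebra.mem_centralizer_iff k |>.1 hg s rfl).symm
  have hb : b ∈ Subalgebra.centralizer k (Set.univ : Set Q) := h2 ▸ Algebra.mem_top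
  exact Subalgebra.mem_centralizer_iff k |>.1 hb a trivial

/-- A nonzero polynomial is `X ^ m` times a nonzero constant times a polynomial with constant
coefficient `1`. -/
lemma exists_eq_X_pow_mul_C_mul {p : k[X]} (hp : p ≠ 0) :
    ∃ (m : ℕ) (c : k) (q : k[X]), c ≠ 0 ∧ q.coeff 0 = 1 ∧ p = X ^ m * (C c * q) := by
  obtain ⟨q, hq, hd⟩ := exists_eq_pow_rootMultiplicity_mul_and_not_dvd p hp 0
  rw [C_0, sub_zero] at hq hd
  have hc : q.coeff 0 ≠ 0 := fun h => hd (X_dvd_iff.2 h)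
  refine ⟨p.rootMultiplicity 0, q.coeff 0, C (q.coeff 0)⁻¹ * q, hc, ?_, ?_⟩
  · simp [hc]
  · rw [← mul_assoc (C _), ← C_mul, mul_inv_cancel₀ hc, C_1, one_mul]
    exact hq

lemma exists_algEquiv_ratFunc_of_comm {Q : Type*} [CommRing Q] [Algebra k Q] [Nontrivial Q]
    {s t : Q} (h : RationallyGenerated k s t) (hst : s * t = 1)
    (hu : ∀ p : k[X], p.coeff 0 = 1 → IsUnit (aeval s p)) :
    ∃ e : Q ≃ₐ[k] RatFunc k, e s = RatFunc.X ∧ e t = RatFunc.X⁻¹ := by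
  have hunit : ∀ p : k[X], p ≠ 0 → IsUnit (aeval s p) := by
    intro p hp
    obtain ⟨m, c, q, hc, hq, rfl⟩ := exists_eq_X_pow_mul_C_mul hp
    simp only [map_mul, map_pow, aeval_X, aeval_C]
    exact ((IsUnit.of_mul_eq_one _ hst).pow m).mul
      (((isUnit_iff_ne_zero.2 hc).map (algebraMap k Q)).mul (hu q hq))
  have hM : ∀ y : nonZeroDivisors k[X], IsUnit ((aeval s : k[X] →ₐ[k] Q) y) :=
    fun y => hunit y (nonZeroDivisors.coe_ne_zero y)
  let φ : RatFunc k →ₐ[k] Q := IsLocalization.liftAlgHom hM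
  have hφ : ∀ p : k[X], φ (algebraMap k[X] (RatFunc k) p) = aeval s p := fun p =>
    IsLocalization.lift_eq hM p
  have hφX : φ RatFunc.X = s := by rw [← RatFunc.algebraMap_X, hφ, aeval_X]
  have hinv : ∀ (r : RatFunc k) (y : Q), r ≠ 0 → φ r * y = 1 → φ r⁻¹ = y := by
    intro r y hr hy
    calc φ r⁻¹ = φ r⁻¹ * (φ r * y) := by rw [hy, mul_one]
      _ = y := by rw [← mul_assoc, ← map_mul, inv_mul_cancel₀ hr, map_one, one_mul]
  have hφt : φ RatFunc.X⁻¹ = t := hinv _ _ RatFunc.X_ne_zero (by rw [hφX, hst])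
  have hrange : φ.range = ⊤ := by
    have hne : ∀ (r : RatFunc k) (y : Q), φ r * y = 1 → y ∈ φ.range := by
      intro r y hy
      refine ⟨r⁻¹, hinv r y ?_ hy⟩
      rintro rfl
      simp at hy
    refine h _ ⟨_, hφX⟩ ⟨_, hφt⟩ (fun p _ y _ h2 => hne (aeval RatFunc.X p) y ?_)
      (fun p _ y _ h2 => hne (aeval RatFunc.X⁻¹ p) y ?_)
    · rwa [← AlgHom.coe_toRingHom, AlgHom.coe_toRingHom, ← aeval_algHom_apply, hφX]
    · rwa [← aeval_algHom_apply, hφt]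
  let e := AlgEquiv.ofBijective φ ⟨φ.toRingHom.injective, AlgHom.range_eq_top φ |>.1 hrange⟩
  refine ⟨e.symm, ?_, ?_⟩
  · rw [AlgEquiv.symm_apply_eq]; exact hφX.symm
  · rw [AlgEquiv.symm_apply_eq]; exact hφt.symm

lemma exists_algEquiv_ratFunc {Q : Type*} [Ring Q] [Algebra k Q] [Nontrivial Q]
    {s t : Q} (h : RationallyGenerated k s t) (hst : s * t = 1) (hts : t * s = 1)
    (hu : ∀ p : k[X], p.coeff 0 = 1 → IsUnit (aeval s p)) :
    ∃ e : Q ≃ₐ[k] RatFunc k, e s = RatFunc.X ∧ e t = RatFunc.X⁻¹ := by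
  let _ : CommRing Q := { ‹Ring Q› with mul_comm := h.mul_comm hst hts }
  exact exists_algEquiv_ratFunc_of_comm h hst hu

end Generic

section Matrices

variable (k : Type*) [Field k]

lemma sT_pow_apply_eq_zero (n m : ℕ) (i j : Fin (n + 1)) (h : (i : ℕ) < j + m) :
    (sT k n ^ m) i j = 0 := by
  induction m generalizing i with
  | zero => rw [pow_zero, Matrix.one_apply_ne]; rintro rfl; omega
  | succ m ih =>
    rw [pow_succ', Matrix.mul_apply]
    refine Finset.sum_eq_zero fun l _ => ?_
    by_cases hl : (i : ℕ) = l + 1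
    · rw [ih l (by omega), mul_zero]
    · simp [sT, hl]

lemma isNilpotent_sT (n : ℕ) : IsNilpotent (sT k n) :=
  ⟨n + 1, by ext i j; exact sT_pow_apply_eq_zero k n (n + 1) i j (by omega)⟩

lemma isNilpotent_sstarT (n : ℕ) : IsNilpotent (sstarT k n) := by
  obtain ⟨m, hm⟩ := isNilpotent_sT k n
  exact ⟨m, by rw [sstarT, ← Matrix.transpose_pow, hm, Matrix.transpose_zero]⟩

variable {k} in
lemma isUnit_aeval_of_isNilpotent {A : Type*} [Ring A] [Algebra k A] {a : A} (ha : IsNilpotent a)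
    {p : k[X]} (hp : p.coeff 0 = 1) : IsUnit (aeval a p) := by
  rw [← X_mul_divX_add p, hp, map_add, map_mul, aeval_X, C_1, map_one]
  refine IsNilpotent.isUnit_add_one (Commute.isNilpotent_mul_right ?_ ha)
  simpa using (Commute.all X p.divX).map (aeval a)

variable {k} in
lemma isUnit_aeval_of_forall_isNilpotent {a : TProd k} (ha : ∀ n, IsNilpotent (a n))
    {p : k[X]} (hp : p.coeff 0 = 1) : IsUnit (aeval a p) := by
  rw [Pi.isUnit_iff]
  intro n
  have := aeval_algHom_apply (Pi.evalAlgHom k (fun n => Matrix (Fin (n + 1)) (Fin (n + 1)) k) n) a p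
  change IsUnit (Pi.evalAlgHom k (fun n => Matrix (Fin (n + 1)) (Fin (n + 1)) k) n (aeval a p))
  rw [← this]
  exact isUnit_aeval_of_isNilpotent (ha n) hp

lemma rank_one_sub_sT_mul_sstarT_le (n : ℕ) :
    ((1 - sT k * sstarT k : TProd k) n).rank ≤ 1 := by
  have h : (1 - sT k * sstarT k : TProd k) n =
      Matrix.vecMulVec (Pi.single 0 1) (Pi.single 0 1) := by
    ext i j
    change (1 - sT k n * (sT k n).transpose) i j = _
    rw [Matrix.sub_apply, Matrix.mul_apply, Matrix.vecMulVec_apply]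
    simp only [sT, Matrix.transpose_apply, Matrix.of_apply]
    induction i using Fin.cases with
    | zero => simp [Matrix.one_apply, Pi.single_apply, eq_comm]
    | succ i =>
      rw [Finset.sum_eq_single i.castSucc]
      · simp [Matrix.one_apply, Fin.ext_iff, eq_comm (a := (j : ℕ))]
      · intro l _ hl
        rw [if_neg, zero_mul]
        intro h
        exact hl (Fin.ext (by simp at h; simp [h]))
      · simp
  rw [h]
  exact Matrix.rank_vecMulVec_le _ _

variable {k} in
lemma matrix_rank_add_le {n : ℕ} (A B : Matrix (Fin n) (Fin n) k) :
    (A + B).rank ≤ A.rank + B.rank := by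
  have h := LinearMap.rank_add_le A.mulVecLin B.mulVecLin
  rw [← Matrix.mulVecLin_add] at h
  simp only [LinearMap.rank, ← Module.finrank_eq_rank] at h
  exact_mod_cast h

/-- The two-sided ideal of families of matrices of bounded rank. -/
def boundedRank : TwoSidedIdeal (TProd k) :=
  TwoSidedIdeal.mk' {x | ∃ m : ℕ, ∀ n, (x n).rank ≤ m}
    ⟨0, fun n => by simp⟩
    (by
      rintro x y ⟨a, ha⟩ ⟨b, hb⟩
      exact ⟨a + b, fun n => (matrix_rank_add_le _ _).trans (add_le_add (ha n) (hb n))⟩)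
    (by
      rintro x ⟨a, ha⟩
      refine ⟨a, fun n => ?_⟩
      have : (-x) n = -1 * x n := by simp
      rw [this]
      exact (Matrix.rank_mul_le_right _ _).trans (ha n))
    (by
      rintro x y ⟨a, ha⟩
      exact ⟨a, fun n => (Matrix.rank_mul_le_right _ _).trans (ha n)⟩)
    (by
      rintro x y ⟨a, ha⟩
      exact ⟨a, fun n => (Matrix.rank_mul_le_left _ _).trans (ha n)⟩)

lemma one_notMem_boundedRank : (1 : TProd k) ∉ boundedRank k := by
  rw [boundedRank, TwoSidedIdeal.mem_mk']
  rintro ⟨m, hm⟩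
  have := hm m
  rw [Pi.one_apply, Matrix.rank_one, Fintype.card_fin] at this
  omega

end Matrices

section Dalg

variable (k : Type*) [Field k]

/-- The element `s` of `𝓓`. -/
noncomputable def sD : Dalg k := ⟨sT k, Algebra.subset_adjoin (by simp)⟩

/-- The element `s*` of `𝓓`. -/
noncomputable def sstarD : Dalg k := ⟨sstarT k, Algebra.subset_adjoin (by simp)⟩

variable {k}

lemma coe_aeval_Dalg (a : Dalg k) (p : k[X]) : (aeval a p : Dalg k) = aeval (a : TProd k) p :=
  (aeval_algHom_apply (Dalg k).val a p).symm

lemma isUnit_aeval_Dalg {a : Dalg k} {p : k[X]} (hu : IsUnit (aeval (a : TProd k) p))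
    (h : Ring.inverse (aeval (a : TProd k) p) ∈ Dalg k) : IsUnit (aeval a p) :=
  ⟨⟨aeval a p, ⟨_, h⟩,
    Subtype.ext <| by simpa [coe_aeval_Dalg] using Ring.mul_inverse_cancel _ hu,
    Subtype.ext <| by simpa [coe_aeval_Dalg] using Ring.inverse_mul_cancel _ hu⟩, rfl⟩

lemma isUnit_aeval_sD {p : k[X]} (hp : p.coeff 0 = 1) : IsUnit (aeval (sD k) p) :=
  isUnit_aeval_Dalg (isUnit_aeval_of_forall_isNilpotent (isNilpotent_sT k) hp)
    (Algebra.subset_adjoin (Or.inr ⟨p, hp, Or.inl rfl⟩))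

lemma isUnit_aeval_sstarD {p : k[X]} (hp : p.coeff 0 = 1) : IsUnit (aeval (sstarD k) p) :=
  isUnit_aeval_Dalg (isUnit_aeval_of_forall_isNilpotent (isNilpotent_sstarT k) hp)
    (Algebra.subset_adjoin (Or.inr ⟨p, hp, Or.inr rfl⟩))

lemma isUnit_one_sub_sD : IsUnit (1 - sD k) := by
  have h := isUnit_aeval_sD (k := k) (p := 1 - X) (by simp)
  rwa [map_sub, map_one, aeval_X] at h

lemma isUnit_one_sub_sstarD : IsUnit (1 - sstarD k) := by
  have h := isUnit_aeval_sstarD (k := k) (p := 1 - X) (by simp)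
  rwa [map_sub, map_one, aeval_X] at h

lemma rationallyGenerated_Dalg : RationallyGenerated k (sD k) (sstarD k) := by
  intro C hs ht hys hyt
  have hle : Dalg k ≤ C.map (Dalg k).val := by
    refine Algebra.adjoin_le ?_
    rintro y ((rfl | rfl) | ⟨p, hp, rfl | rfl⟩)
    · exact ⟨_, hs, rfl⟩
    · exact ⟨_, ht, rfl⟩
    · have hu := isUnit_aeval_of_forall_isNilpotent (isNilpotent_sT k) hp
      refine ⟨⟨_, Algebra.subset_adjoin (Or.inr ⟨p, hp, Or.inl rfl⟩)⟩, hys p hp _ ?_ ?_, rfl⟩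
      · exact Subtype.ext <| by
          simpa [coe_aeval_Dalg, sD] using Ring.inverse_mul_cancel _ hu
      · exact Subtype.ext <| by
          simpa [coe_aeval_Dalg, sD] using Ring.mul_inverse_cancel _ hu
    · have hu := isUnit_aeval_of_forall_isNilpotent (isNilpotent_sstarT k) hp
      refine ⟨⟨_, Algebra.subset_adjoin (Or.inr ⟨p, hp, Or.inr rfl⟩)⟩, hyt p hp _ ?_ ?_, rfl⟩
      · exact Subtype.ext <| by
          simpa [coe_aeval_Dalg, sstarD] using Ring.inverse_mul_cancel _ hu
      · exact Subtype.ext <| by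
          simpa [coe_aeval_Dalg, sstarD] using Ring.mul_inverse_cancel _ hu
  refine eq_top_iff.2 fun x _ => ?_
  obtain ⟨y, hy, hyx⟩ := hle x.2
  rwa [← Subtype.ext hyx]

end Dalg

section TwoSided

variable {A : Type*} [Ring A] (I : TwoSidedIdeal A)

lemma ringCon_mk'_eq_zero_iff {x : A} : I.ringCon.mk' x = 0 ↔ x ∈ I := by
  rw [← TwoSidedIdeal.mem_ker, TwoSidedIdeal.ker_ringCon_mk']

variable {I} in
lemma one_sub_mul_mem_symm {a b : A} (ha : IsUnit (1 - a)) (hb : IsUnit (1 - b))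
    (h : 1 - a * b ∈ I) : 1 - b * a ∈ I := by
  rw [← ringCon_mk'_eq_zero_iff, map_sub, map_mul, map_one, sub_eq_zero, eq_comm] at h ⊢
  refine mul_eq_one_symm_of_isUnit h ?_ ?_
  · simpa using ha.map I.ringCon.mk'
  · simpa using hb.map I.ringCon.mk'

/-- The quotient of a rationally generated algebra by a proper ideal that makes `s` and `t` mutually
inverse is the rational function field. -/
theorem exists_algHom_ratFunc_of_twoSidedIdeal {k : Type*} [Field k] [Algebra k A] {s t : A}
    (h : RationallyGenerated k s t) (hu : ∀ p : k[X], p.coeff 0 = 1 → IsUnit (aeval s p))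
    (h1 : 1 ∉ I) (hst : 1 - s * t ∈ I) (hts : 1 - t * s ∈ I) :
    ∃ g : A →ₐ[k] RatFunc k, Function.Surjective g ∧ (∀ x, g x = 0 ↔ x ∈ I) ∧
      g s = RatFunc.X ∧ g t = RatFunc.X⁻¹ := by
  let π : A →ₐ[k] I.ringCon.Quotient := RingCon.mkₐ k I.ringCon
  have hπ : ∀ x, π x = 0 ↔ x ∈ I := fun x => ringCon_mk'_eq_zero_iff I
  have hπs : Function.Surjective π := I.ringCon.mk'_surjective
  have hone : ∀ a b : A, 1 - a * b ∈ I → π a * π b = 1 := by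
    intro a b hab
    rw [← hπ, map_sub, map_mul, map_one, sub_eq_zero] at hab
    exact hab.symm
  have : Nontrivial I.ringCon.Quotient := ⟨π 1, 0, fun h => h1 ((hπ 1).1 h)⟩
  obtain ⟨e, hes, het⟩ := exists_algEquiv_ratFunc (h.map π hπs) (hone s t hst) (hone t s hts)
    fun p hp => by
      rw [aeval_algHom_apply]
      exact (hu p hp).map π
  refine ⟨e.toAlgHom.comp π, e.surjective.comp hπs, fun x => ?_, hes, het⟩
  rw [← hπ x]
  exact map_eq_zero_iff e e.injective

end TwoSided

lemma span_le_comap_boundedRank (k : Type*) [Field k] :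
    TwoSidedIdeal.span {1 - sD k * sstarD k} ≤ (boundedRank k).comap (Dalg k).val := by
  rw [TwoSidedIdeal.span_le, Set.singleton_subset_iff, SetLike.mem_coe,
    TwoSidedIdeal.mem_comap, boundedRank, TwoSidedIdeal.mem_mk']
  exact ⟨1, rank_one_sub_sT_mul_sstarT_le k⟩

/-- The ideals of `𝓓` generated by `1 - s s*` and `1 - s* s` agree, and the quotient is `k(x)`. -/
theorem span_eq_span_and_exists_ratFunc (k : Type*) [Field k] (I J : TwoSidedIdeal (Dalg k))
    (hI : I = TwoSidedIdeal.span {1 - sD k * sstarD k})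
    (hJ : J = TwoSidedIdeal.span {1 - sstarD k * sD k}) :
    I = J ∧ ∃ g : Dalg k →ₐ[k] RatFunc k, Function.Surjective g ∧ (∀ x, g x = 0 ↔ x ∈ I) ∧
      g (sD k) = RatFunc.X ∧ g (sstarD k) = RatFunc.X⁻¹ := by
  have hmI : 1 - sD k * sstarD k ∈ I := by
    rw [hI]
    exact TwoSidedIdeal.subset_span (Set.mem_singleton _)
  have hmJ : 1 - sstarD k * sD k ∈ J := by
    rw [hJ]
    exact TwoSidedIdeal.subset_span (Set.mem_singleton _)
  have hmI' : 1 - sstarD k * sD k ∈ I :=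
    one_sub_mul_mem_symm isUnit_one_sub_sD isUnit_one_sub_sstarD hmI
  have hmJ' : 1 - sD k * sstarD k ∈ J :=
    one_sub_mul_mem_symm isUnit_one_sub_sstarD isUnit_one_sub_sD hmJ
  have hIJ : I ≤ J := by
    rw [hI, TwoSidedIdeal.span_le]
    exact Set.singleton_subset_iff.2 hmJ'
  have hJI : J ≤ I := by
    rw [hJ, TwoSidedIdeal.span_le]
    exact Set.singleton_subset_iff.2 hmI'
  have h1 : (1 : Dalg k) ∉ I := by
    intro h
    have h' := span_le_comap_boundedRank k (show 1 ∈ _ by rwa [← hI])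
    rw [TwoSidedIdeal.mem_comap, map_one] at h'
    exact one_notMem_boundedRank k h'
  refine ⟨le_antisymm hIJ hJI, ?_⟩
  exact exists_algHom_ratFunc_of_twoSidedIdeal I rationallyGenerated_Dalg
    (fun _ => isUnit_aeval_sD) h1 hmI hmI'

end LampAlg

open LampAlg in
/-- Proposition 6.7 of the paper: in `𝓓`, the two-sided ideal generated by `1 − s s*`
coincides with the two-sided ideal generated by `1 − s* s`, and the quotient
`𝓓/⟨1 − s s*⟩` is isomorphic as a `k`-algebra to the rational function field `k(x)`,
with the class of `s` corresponding to `x` and the class of `s*` to `x⁻¹`. -/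
theorem stmt18 (K : Subfield ℂ) (hK : ∀ z ∈ K, (starRingEnd ℂ) z ∈ K)
    (I J : TwoSidedIdeal (Dalg K))
    (hI : I = TwoSidedIdeal.span {x : Dalg K | (x : TProd K) = 1 - sT K * sstarT K})
    (hJ : J = TwoSidedIdeal.span {x : Dalg K | (x : TProd K) = 1 - sstarT K * sT K}) :
    I = J ∧
    ∃ g : (Dalg K) →+* RatFunc K,
      Function.Surjective g ∧
      (∀ x : Dalg K, g x = 0 ↔ x ∈ I) ∧
      (∀ x : Dalg K, (x : TProd K) = sT K → g x = RatFunc.X) ∧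
      (∀ x : Dalg K, (x : TProd K) = sstarT K → g x = (RatFunc.X)⁻¹) ∧
      (∀ c : K, g (algebraMap K (Dalg K) c) = algebraMap K (RatFunc K) c) := by
  have hI' : I = TwoSidedIdeal.span {1 - sD K * sstarD K} := by
    rw [hI]
    congr 1
    ext x
    exact (Subtype.ext_iff (a2 := 1 - sD K * sstarD K)).symm
  have hJ' : J = TwoSidedIdeal.span {1 - sstarD K * sD K} := by
    rw [hJ]
    congr 1
    ext x
    exact (Subtype.ext_iff (a2 := 1 - sstarD K * sD K)).symm
  obtain ⟨hIJ, g, hg, hker, hs, ht⟩ := span_eq_span_and_exists_ratFunc K I J hI' hJ'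
  refine ⟨hIJ, g.toRingHom, hg, hker, fun x hx => ?_, fun x hx => ?_, fun c => g.commutes c⟩
  · rw [show x = sD K from Subtype.ext hx]
    exact hs
  · rw [show x = sstarD K from Subtype.ext hx]
    exact ht
end

section
/- For every c ∈ 𝓜 and every v ∈ ped(𝓜) there exist d ∈ 𝓜 and w ∈ ped(𝓜) such that c = d + w and such that the only element e ∈ 𝓜 with e ≤ d and e ≤ v + w is e = 0. -/
namespace CalM

/-- the generators `x_n, y_n, z_n` (`n ≥ 0`) and `a_n` (`n ≥ 1`) of the monoid `𝓜` -/
inductive Gen : Type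
  | x : ℕ → Gen
  | y : ℕ → Gen
  | z : ℕ → Gen
  | a : ℕ → Gen
  deriving DecidableEq

/-- the defining relations of `𝓜`, as relations between elements of the free commutative
monoid (`Multiset Gen`) on the generators -/
inductive Rel : Multiset Gen → Multiset Gen → Prop
  | xyz : Rel {Gen.x 0, Gen.y 0} {Gen.x 0, Gen.z 0}
  | ya (l : ℕ) : Rel {Gen.y l} {Gen.y (l + 1), Gen.a (l + 1)}
  | za (l : ℕ) : Rel {Gen.z l} {Gen.z (l + 1), Gen.a (l + 1)}
  | xy (l : ℕ) : Rel {Gen.x l} {Gen.x (l + 1), Gen.y (l + 1)}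
  | xz (l : ℕ) : Rel {Gen.x l} {Gen.x (l + 1), Gen.z (l + 1)}

/-- the monoid `𝓜`: the quotient of the free commutative monoid on the generators by the
additive congruence generated by the defining relations -/
abbrev M : Type := (addConGen Rel).Quotient

/-- the image of a generator in `𝓜` -/
def gen (g : Gen) : M := (addConGen Rel).mk' {g}

/-- the pedestal of `𝓜`: the submonoid generated by the elements `a_n`, `n ≥ 1` -/
def ped : AddSubmonoid M :=
  AddSubmonoid.closure {m : M | ∃ n : ℕ, 1 ≤ n ∧ m = gen (Gen.a n)}

end CalM

namespace CalM

open Gen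

/-- the homomorphism out of `𝓜` determined by values on the generators respecting the
relations -/
def liftHom {N : Type*} [AddCommMonoid N] (φ : Gen → N)
    (h : ∀ s t, Rel s t → (s.map φ).sum = (t.map φ).sum) : M →+ N :=
  (addConGen Rel).lift (Multiset.sumAddMonoidHom.comp (Multiset.mapAddMonoidHom φ))
    (AddCon.addConGen_le.2 fun s t hst => h s t hst)

theorem liftHom_mk {N : Type*} [AddCommMonoid N] (φ : Gen → N)
    (h : ∀ s t, Rel s t → (s.map φ).sum = (t.map φ).sum) (s : Multiset Gen) :
    liftHom φ h ((addConGen Rel).mk' s) = (s.map φ).sum := rfl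

theorem liftHom_gen {N : Type*} [AddCommMonoid N] (φ : Gen → N)
    (h : ∀ s t, Rel s t → (s.map φ).sum = (t.map φ).sum) (g : Gen) :
    liftHom φ h (gen g) = φ g := by
  rw [gen, liftHom_mk, Multiset.map_singleton, Multiset.sum_singleton]

/-- the values on generators of the `j`-th coordinate, counting occurrences of `a_j` -/
def coordVal (j : ℕ) : Gen → ℕ
  | x l => j - l - 1
  | y l => if l < j then 1 else 0
  | z l => if l < j then 1 else 0
  | a l => if l = j then 1 else 0

/-- the `j`-th coordinate, counting the occurrences of `a_j` below an element -/
def coord (j : ℕ) : M →+ ℕ :=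
  liftHom (coordVal j) fun s t h => by
    cases h <;> simp [coordVal] <;> grind

/-- the values on generators of the length homomorphism -/
def lengthVal : Gen → ℕ∞
  | a _ => 1
  | _ => ⊤

/-- the homomorphism sending each `a_n` to `1` and the other generators to `⊤` -/
def length : M →+ ℕ∞ :=
  liftHom lengthVal fun s t h => by
    cases h <;> simp [lengthVal]

theorem gen_y (l : ℕ) : gen (y l) = gen (y (l + 1)) + gen (a (l + 1)) :=
  (AddCon.eq _).2 (AddConGen.Rel.of _ _ (Rel.ya l))

theorem gen_z (l : ℕ) : gen (z l) = gen (z (l + 1)) + gen (a (l + 1)) :=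
  (AddCon.eq _).2 (AddConGen.Rel.of _ _ (Rel.za l))

theorem gen_x (l : ℕ) : gen (x l) = gen (x (l + 1)) + gen (y (l + 1)) :=
  (AddCon.eq _).2 (AddConGen.Rel.of _ _ (Rel.xy l))

theorem coord_gen (j : ℕ) (g : Gen) : coord j (gen g) = coordVal j g :=
  liftHom_gen _ _ g

/-- the elements not involving `a_1, …, a_m` -/
def upper (m : ℕ) : AddSubmonoid M where
  carrier := {d | ∀ j, 1 ≤ j → j ≤ m → coord j d = 0}
  zero_mem' := by simp
  add_mem' := by simp +contextual

/-- the elements of the pedestal involving only `a_1, …, a_m` -/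
def lower (m : ℕ) : AddSubmonoid M where
  carrier := {w | w ∈ ped ∧ ∀ j, ¬ (1 ≤ j ∧ j ≤ m) → coord j w = 0}
  zero_mem' := ⟨zero_mem _, by simp⟩
  add_mem' := fun hu hw => ⟨add_mem hu.1 hw.1, fun j hj => by
    rw [map_add, hu.2 j hj, hw.2 j hj]⟩

theorem gen_a_mem_lower {m n : ℕ} (h : 1 ≤ n) (hn : n ≤ m) : gen (a n) ∈ lower m :=
  ⟨AddSubmonoid.subset_closure ⟨n, h, rfl⟩, fun j hj => by
    rw [coord_gen, coordVal, if_neg]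
    rintro rfl
    exact hj ⟨h, hn⟩⟩

theorem gen_mem_upper {m : ℕ} {g : Gen} (h : ∀ j, 1 ≤ j → j ≤ m → coordVal j g = 0) :
    gen g ∈ upper m :=
  fun j h1 h2 => (coord_gen j g).trans (h j h1 h2)

theorem gen_y_mem_sup {l m : ℕ} (h : l ≤ m) : gen (y l) ∈ upper m ⊔ lower m := by
  induction h using Nat.decreasingInduction with
  | self => exact AddSubmonoid.mem_sup_left (gen_mem_upper fun j _ _ => by grind [coordVal])
  | of_succ k hk ih =>
    rw [gen_y]
    exact add_mem ih (AddSubmonoid.mem_sup_right (gen_a_mem_lower (by lia) hk))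

theorem gen_z_mem_sup {l m : ℕ} (h : l ≤ m) : gen (z l) ∈ upper m ⊔ lower m := by
  induction h using Nat.decreasingInduction with
  | self => exact AddSubmonoid.mem_sup_left (gen_mem_upper fun j _ _ => by grind [coordVal])
  | of_succ k hk ih =>
    rw [gen_z]
    exact add_mem ih (AddSubmonoid.mem_sup_right (gen_a_mem_lower (by lia) hk))

theorem gen_x_mem_sup {l m : ℕ} (h : l ≤ m) : gen (x l) ∈ upper m ⊔ lower m := by
  induction h using Nat.decreasingInduction with
  | self => exact AddSubmonoid.mem_sup_left (gen_mem_upper fun j _ _ => by grind [coordVal])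
  | of_succ k hk ih =>
    rw [gen_x]
    exact add_mem ih (gen_y_mem_sup hk)

theorem gen_a_mem_sup {l m : ℕ} (h : l ≤ m) : gen (a l) ∈ upper m ⊔ lower m := by
  rcases Nat.eq_zero_or_pos l with rfl | hl
  · exact AddSubmonoid.mem_sup_left (gen_mem_upper fun j _ _ => by grind [coordVal])
  · exact AddSubmonoid.mem_sup_right (gen_a_mem_lower hl h)

theorem eventually_mem_sup (c : M) : ∀ᶠ m in Filter.atTop, c ∈ upper m ⊔ lower m := by
  obtain ⟨s, rfl⟩ := AddCon.mk'_surjective c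
  induction s using Multiset.induction with
  | empty => exact Filter.Eventually.of_forall fun m => zero_mem _
  | cons g s ih =>
    have hg : ∀ᶠ m in Filter.atTop, gen g ∈ upper m ⊔ lower m := by
      cases g with
      | x l => exact (Filter.eventually_ge_atTop l).mono fun _ => gen_x_mem_sup
      | y l => exact (Filter.eventually_ge_atTop l).mono fun _ => gen_y_mem_sup
      | z l => exact (Filter.eventually_ge_atTop l).mono fun _ => gen_z_mem_sup
      | a l => exact (Filter.eventually_ge_atTop l).mono fun _ => gen_a_mem_sup
    filter_upwards [hg, ih] with m h1 h2
    rw [← Multiset.singleton_add, map_add]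
    exact add_mem h1 h2

theorem eventually_mem_lower {v : M} (hv : v ∈ ped) :
    ∀ᶠ m in Filter.atTop, v ∈ lower m := by
  induction hv using AddSubmonoid.closure_induction with
  | mem v h =>
    obtain ⟨n, hn, rfl⟩ := h
    exact (Filter.eventually_ge_atTop n).mono fun _ => gen_a_mem_lower hn
  | zero => exact Filter.Eventually.of_forall fun m => zero_mem _
  | add u v _ _ hu hv => filter_upwards [hu, hv] with m h1 h2 using add_mem h1 h2

theorem length_ne_top_of_mem_ped {v : M} (hv : v ∈ ped) : length v ≠ ⊤ := by
  induction hv using AddSubmonoid.closure_induction with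
  | mem v h =>
    obtain ⟨n, -, rfl⟩ := h
    rw [length, liftHom_gen]
    exact ENat.one_ne_top
  | zero => simp
  | add u v _ _ hu hv => simp [hu, hv]

theorem eq_zero_of_length_ne_top {e : M} (h : length e ≠ ⊤) (h0 : ∀ j, coord j e = 0) :
    e = 0 := by
  obtain ⟨s, rfl⟩ := AddCon.mk'_surjective e
  obtain rfl | ⟨g, hg⟩ := s.empty_or_exists_mem
  · exact map_zero _
  obtain ⟨t, rfl⟩ := Multiset.exists_cons_of_mem hg
  rw [length, liftHom_mk, Multiset.map_cons, Multiset.sum_cons] at h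
  cases g with
  | a l =>
    have hl := h0 l
    rw [coord, liftHom_mk, Multiset.map_cons, Multiset.sum_cons] at hl
    simp [coordVal] at hl
  | x l => simp [lengthVal] at h
  | y l => simp [lengthVal] at h
  | z l => simp [lengthVal] at h

end CalM

open CalM in
/-- Property (3) in the proof of Proposition 3.4 of the paper: for `c ∈ 𝓜` and
`v ∈ ped(𝓜)` there are `d ∈ 𝓜`, `w ∈ ped(𝓜)` with `c = d + w` and `d ∧ (v + w) = 0`
(the only common lower bound of `d` and `v + w` in the algebraic preorder is `0`). -/
theorem stmt19 :
    ∀ c : M, ∀ v ∈ ped, ∃ d : M, ∃ w ∈ ped, c = d + w ∧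
      ∀ e : M, (∃ d' : M, d = e + d') → (∃ w' : M, v + w = e + w') → e = 0 := by
  intro c v hv
  obtain ⟨m, hc, hvm⟩ := ((eventually_mem_sup c).and (eventually_mem_lower hv)).exists
  obtain ⟨d, hd, w, hw, rfl⟩ := AddSubmonoid.mem_sup.1 hc
  refine ⟨d, w, hw.1, rfl, ?_⟩
  rintro e ⟨d', rfl⟩ ⟨w', hw'⟩
  have hvw := add_mem hvm hw
  rw [hw'] at hvw
  refine eq_zero_of_length_ne_top (fun h => length_ne_top_of_mem_ped hvw.1 ?_) fun j => ?_
  · rw [map_add, h, top_add]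
  · by_cases hj : 1 ≤ j ∧ j ≤ m
    · have := hd j hj.1 hj.2
      rw [map_add] at this
      lia
    · have := hvw.2 j hj
      rw [map_add] at this
      lia
end
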